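/- For all C₁ > 0 there exist constants c₂ > 0 and universal constants C, c > 0 such that the following is true. Let n ≥ 2, 1 ≤ p < C₁·ln n, ε ∈ (0,1), and define d' = c·n·ε² if 1 ≤ p ≤ 2, and d' = c₂·min{c^p·n·ε², p·n^{2/p}·ε^{2/p}} if 2 < p < C₁·ln n. Let G be an n×k random matrix with i.i.d. standard normal entries, where k ≤ d'. Then with probability at least 1 − C·exp(−c·d'), for all x ∈ ℝ^k: (1−ε)·M_p·|x| ≤ ‖Gx‖_p ≤ (1+ε)·M_p·|x|, where M_p = 𝕄 ‖Ge₁‖_p. -/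

import Mathlib

open MeasureTheory ProbabilityTheory

/-- The standard Gaussian measure `N(0, I_n)` on `ℝ^n`. -/
noncomputable def stdGaussian (n : ℕ) : Measure (Fin n → ℝ) :=
  Measure.pi fun _ => gaussianReal 0 1

/-- The law of an `n × k` random matrix with i.i.d. standard normal entries. -/
noncomputable def gaussMatrix (n k : ℕ) : Measure (Fin n → Fin k → ℝ) :=
  Measure.pi fun _ => Measure.pi fun _ => gaussianReal 0 1

/-- `mulVec g x = Gx`, the matrix-vector product. -/
noncomputable def mulVec {n k : ℕ} (g : Fin n → Fin k → ℝ) (x : Fin k → ℝ) : Fin n → ℝ :=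
  fun i => ∑ j : Fin k, g i j * x j

/-- The Euclidean norm on `Fin k → ℝ`. -/
noncomputable def eucNorm {k : ℕ} (x : Fin k → ℝ) : ℝ :=
  Real.sqrt (∑ j : Fin k, x j ^ 2)

/-- The `ℓ_p` norm `(∑ |x_i|^p)^{1/p}` on `Fin n → ℝ`. -/
noncomputable def pNorm {n : ℕ} (p : ℝ) (x : Fin n → ℝ) : ℝ :=
  (∑ i : Fin n, |x i| ^ p) ^ (1 / p)

/-- `m` is a median of `f` under `μ`. -/
def IsMedian {α : Type*} [MeasurableSpace α] (μ : Measure α) (f : α → ℝ) (m : ℝ) : Prop :=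
  (1 : ENNReal) / 2 ≤ μ {x | m ≤ f x} ∧ (1 : ENNReal) / 2 ≤ μ {x | f x ≤ m}

section Law

variable {n k : ℕ}

lemma integral_cexp_pi_gaussian (t : Fin k → ℝ) :
    ∫ z, Complex.exp ((∑ j, z j * t j : ℝ) * Complex.I)
      ∂(Measure.pi fun _ : Fin k => gaussianReal 0 1) =
    Complex.exp (-(∑ j, t j ^ 2 : ℝ) / 2) := by
  have h1 : ∀ z : Fin k → ℝ, Complex.exp ((∑ j, z j * t j : ℝ) * Complex.I) =
      ∏ j, Complex.exp (t j * z j * Complex.I) := by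
    intro z
    rw [← Complex.exp_sum]
    congr 1
    push_cast
    rw [Finset.sum_mul]
    exact Finset.sum_congr rfl fun j _ => by ring
  simp_rw [h1]
  rw [integral_fintype_prod_eq_prod (f := fun j (z : ℝ) => Complex.exp (t j * z * Complex.I))]
  simp_rw [← charFun_apply_real, charFun_gaussianReal]
  rw [← Complex.exp_sum]
  congr 1
  push_cast
  rw [neg_div, Finset.sum_div, ← Finset.sum_neg_distrib]
  exact Finset.sum_congr rfl fun j _ => by simp

lemma map_pair_pi_gaussian {x y : Fin k → ℝ} (hx : ∑ j, x j ^ 2 = 1) (hy : ∑ j, y j ^ 2 = 1)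
    (hxy : ∑ j, x j * y j = 0) :
    (Measure.pi fun _ : Fin k => gaussianReal 0 1).map
      (fun z => (∑ j, z j * x j, ∑ j, z j * y j)) =
    (gaussianReal 0 1).prod (gaussianReal 0 1) := by
  have hm : Measurable fun z : Fin k → ℝ => (∑ j, z j * x j, ∑ j, z j * y j) := by fun_prop
  have := Measure.isProbabilityMeasure_map (μ := Measure.pi fun _ : Fin k => gaussianReal 0 1)
    hm.aemeasurable
  refine Measure.ext_of_charFunDual (funext fun L => ?_)
  rw [charFunDual_prod]
  set a := L (1, 0) with ha
  set b := L (0, 1) with hb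
  have hL : ∀ u v : ℝ, L (u, v) = u * a + v * b := by
    intro u v
    have : ((u, v) : ℝ × ℝ) = u • (1, 0) + v • (0, 1) := by simp
    rw [this, map_add, map_smul, map_smul]; simp [ha, hb]
  have h1 : charFunDual (gaussianReal 0 1) (L.comp (.inl ℝ ℝ ℝ)) = Complex.exp (-(a ^ 2 : ℝ) / 2) := by
    have := charFun_gaussianReal (μ := 0) (v := 1) a
    rw [charFun_apply_real] at this
    rw [charFunDual_apply]
    simp only [ContinuousLinearMap.comp_apply, ContinuousLinearMap.inl_apply, hL]
    convert this using 1
    · congr 1; ext z; congr 2; push_cast; ring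
    · congr 1; push_cast; simp [neg_div]
  have h2 : charFunDual (gaussianReal 0 1) (L.comp (.inr ℝ ℝ ℝ)) = Complex.exp (-(b ^ 2 : ℝ) / 2) := by
    have := charFun_gaussianReal (μ := 0) (v := 1) b
    rw [charFun_apply_real] at this
    rw [charFunDual_apply]
    simp only [ContinuousLinearMap.comp_apply, ContinuousLinearMap.inr_apply, hL]
    convert this using 1
    · congr 1; ext z; congr 2; push_cast; ring
    · congr 1; push_cast; simp [neg_div]
  rw [h1, h2, charFunDual_apply, integral_map hm.aemeasurable
    (Continuous.aestronglyMeasurable (by fun_prop))]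
  have h3 : ∀ z : Fin k → ℝ, L (∑ j, z j * x j, ∑ j, z j * y j) =
      ∑ j, z j * (a * x j + b * y j) := by
    intro z
    rw [hL, Finset.sum_mul, Finset.sum_mul, ← Finset.sum_add_distrib]
    exact Finset.sum_congr rfl fun j _ => by ring
  simp_rw [h3]
  rw [integral_cexp_pi_gaussian, ← Complex.exp_add]
  congr 1
  have h4 : ∑ j, (a * x j + b * y j) ^ 2 = a ^ 2 + b ^ 2 := by
    have : ∀ j, (a * x j + b * y j) ^ 2 =
      a ^ 2 * x j ^ 2 + 2 * a * b * (x j * y j) + b ^ 2 * y j ^ 2 := fun j => by ring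
    simp_rw [this, Finset.sum_add_distrib, ← Finset.mul_sum, hx, hy, hxy]; ring
  rw [h4]; push_cast; ring

instance : IsProbabilityMeasure (_root_.stdGaussian n) := by
  unfold _root_.stdGaussian; infer_instance

instance : IsProbabilityMeasure (gaussMatrix n k) := by
  unfold gaussMatrix; infer_instance

lemma continuous_mulVec : Continuous fun z : (Fin n → Fin k → ℝ) × (Fin k → ℝ) =>
    mulVec z.1 z.2 := by
  unfold mulVec; fun_prop

lemma measurePreserving_mulVec_pair {x y : Fin k → ℝ} (hx : ∑ j, x j ^ 2 = 1)
    (hy : ∑ j, y j ^ 2 = 1) (hxy : ∑ j, x j * y j = 0) :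
    MeasurePreserving (fun g : Fin n → Fin k → ℝ => (mulVec g x, mulVec g y)) (gaussMatrix n k)
      ((_root_.stdGaussian n).prod (_root_.stdGaussian n)) := by
  have h1 : MeasurePreserving
      (fun (g : Fin n → Fin k → ℝ) i => (∑ j, g i j * x j, ∑ j, g i j * y j)) (gaussMatrix n k)
      (Measure.pi fun _ : Fin n => (gaussianReal 0 1).prod (gaussianReal 0 1)) := by
    refine measurePreserving_pi _ _ fun i => ⟨by fun_prop, map_pair_pi_gaussian hx hy hxy⟩
  exact (measurePreserving_arrowProdEquivProdArrow ℝ ℝ (Fin n) _ _).comp h1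

lemma map_pi_gaussian_single {x : Fin k → ℝ} (hx : ∑ j, x j ^ 2 = 1) :
    (Measure.pi fun _ : Fin k => gaussianReal 0 1).map (fun z => ∑ j, z j * x j) =
    gaussianReal 0 1 := by
  have hm : Measurable fun z : Fin k → ℝ => ∑ j, z j * x j := by fun_prop
  have := Measure.isProbabilityMeasure_map (μ := Measure.pi fun _ : Fin k => gaussianReal 0 1)
    hm.aemeasurable
  refine Measure.ext_of_charFun (funext fun t => ?_)
  rw [charFun_apply_real, charFun_gaussianReal,
    integral_map hm.aemeasurable (Continuous.aestronglyMeasurable (by fun_prop))]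
  have h := integral_cexp_pi_gaussian (fun j => t * x j)
  have h4 : ∑ j, (t * x j) ^ 2 = t ^ 2 := by simp_rw [mul_pow, ← Finset.mul_sum, hx, mul_one]
  rw [h4] at h
  convert h using 1
  · congr 1; ext z; congr 2; rw [← Complex.ofReal_mul, Finset.mul_sum]; congr 1
    exact Finset.sum_congr rfl fun j _ => by ring
  · congr 1; push_cast; simp [neg_div]

lemma measurePreserving_mulVec {x : Fin k → ℝ} (hx : ∑ j, x j ^ 2 = 1) :
    MeasurePreserving (fun g : Fin n → Fin k → ℝ => mulVec g x) (gaussMatrix n k)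
      (_root_.stdGaussian n) :=
  measurePreserving_pi _ _ fun _ => ⟨by fun_prop, map_pi_gaussian_single hx⟩

end Law

section Rotation

variable {n k : ℕ}

lemma lintegral_exp_sum_stdGaussian (a : Fin n → ℝ) :
    ∫⁻ v, ENNReal.ofReal (Real.exp (∑ i, a i * v i)) ∂(_root_.stdGaussian n) =
      ENNReal.ofReal (Real.exp ((∑ i, a i ^ 2) / 2)) := by
  have h1 : ∀ v : Fin n → ℝ, Real.exp (∑ i, a i * v i) = ∏ i, Real.exp (a i * v i) :=
    fun v => Real.exp_sum _ _
  have hint : Integrable (fun v : Fin n → ℝ => ∏ i, Real.exp (a i * v i))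
      (_root_.stdGaussian n) :=
    Integrable.fintype_prod (f := fun i (z : ℝ) => Real.exp (a i * z))
      fun i => integrable_exp_mul_gaussianReal (a i)
  simp_rw [h1]
  rw [← ofReal_integral_eq_lintegral_ofReal hint
    (Filter.Eventually.of_forall fun v => Finset.prod_nonneg fun i _ => (Real.exp_pos _).le)]
  congr 1
  unfold _root_.stdGaussian
  rw [integral_fintype_prod_eq_prod (f := fun i (z : ℝ) => Real.exp (a i * z))]
  have h2 : ∀ i, ∫ z, Real.exp (a i * z) ∂(gaussianReal 0 1) = Real.exp (a i ^ 2 / 2) := by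
    intro i
    have := congrFun (mgf_id_gaussianReal (μ := 0) (v := 1)) (a i)
    simpa [mgf] using this
  simp_rw [h2]
  rw [← Real.exp_sum, Finset.sum_div]

lemma lintegral_indicator_exp_inner_le {G : (Fin n → ℝ) → Fin n → ℝ} (hG : Continuous G)
    {K : Set (Fin n → ℝ)} (hK : MeasurableSet K) {V : ℝ} (hV : ∀ u ∈ K, ∑ i, G u i ^ 2 ≤ V)
    (t : ℝ) :
    ∫⁻ w, K.indicator 1 w.1 * ENNReal.ofReal (Real.exp (t * ∑ i, G w.1 i * w.2 i))
      ∂((_root_.stdGaussian n).prod (_root_.stdGaussian n)) ≤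
      ENNReal.ofReal (Real.exp (t ^ 2 * V / 2)) := by
  have hm : Measurable fun w : (Fin n → ℝ) × (Fin n → ℝ) =>
      ENNReal.ofReal (Real.exp (t * ∑ i, G w.1 i * w.2 i)) :=
    ENNReal.measurable_ofReal.comp (Continuous.measurable (by fun_prop))
  have hm1 : Measurable fun w : (Fin n → ℝ) × (Fin n → ℝ) => K.indicator (1 : (Fin n → ℝ) → ENNReal) w.1 :=
    (measurable_one.indicator hK).comp measurable_fst
  have hmm := hm1.mul hm
  simp only [Pi.mul_def] at hmm
  rw [lintegral_prod _ hmm.aemeasurable]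
  calc _ ≤ ∫⁻ _u : Fin n → ℝ, ENNReal.ofReal (Real.exp (t ^ 2 * V / 2))
        ∂(_root_.stdGaussian n) := by
        refine lintegral_mono fun u => ?_
        dsimp only
        by_cases hu : u ∈ K
        · simp only [hu, Set.indicator_of_mem, Pi.one_apply, one_mul]
          have : ∀ v : Fin n → ℝ, t * ∑ i, G u i * v i = ∑ i, (t * G u i) * v i := fun v => by
            rw [Finset.mul_sum]; exact Finset.sum_congr rfl fun i _ => by ring
          simp_rw [this, lintegral_exp_sum_stdGaussian, mul_pow, ← Finset.mul_sum]
          gcongr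
          exact hV u hu
        · simp [hu]
    _ = _ := by simp

/-- Jensen's inequality for the exponential along a path parametrised by `[0, 1]`. -/
lemma ofReal_exp_sub_le_lintegral {f f' : ℝ → ℝ} (hf : ∀ s, HasDerivAt f (f' s) s)
    (hf' : Continuous f') (l : ℝ) :
    ENNReal.ofReal (Real.exp (l * (f 1 - f 0))) ≤
      ∫⁻ s in Set.Ioc (0 : ℝ) 1, ENNReal.ofReal (Real.exp (l * f' s)) := by
  have : IsProbabilityMeasure (volume.restrict (Set.Ioc (0 : ℝ) 1)) := ⟨by simp⟩
  have h1 : f 1 - f 0 = ∫ s in Set.Ioc (0 : ℝ) 1, f' s := by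
    rw [← intervalIntegral.integral_of_le zero_le_one]
    exact (intervalIntegral.integral_eq_sub_of_hasDerivAt (fun s _ => hf s)
      (hf'.intervalIntegrable _ _)).symm
  have hint : ∀ φ : ℝ → ℝ, Continuous φ → Integrable φ (volume.restrict (Set.Ioc (0 : ℝ) 1)) :=
    fun φ hφ => (hφ.intervalIntegrable 0 1).1
  have hc : Continuous fun s => Real.exp (l * f' s) := by fun_prop
  rw [← ofReal_integral_eq_lintegral_ofReal (hint _ hc)
    (Filter.Eventually.of_forall fun _ => (Real.exp_pos _).le), h1, ← integral_const_mul]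
  refine ENNReal.ofReal_le_ofReal ?_
  exact convexOn_exp.map_integral_le Real.continuous_exp.continuousOn isClosed_univ
    (by simp) (hint (fun s => l * f' s) (by fun_prop)) (hint _ hc)

lemma continuous_mulVec_const (x : Fin k → ℝ) :
    Continuous fun g : Fin n → Fin k → ℝ => mulVec g x := by
  unfold mulVec; fun_prop

lemma mulVec_linear_comb (g : Fin n → Fin k → ℝ) (x y : Fin k → ℝ) (a b : ℝ) :
    mulVec g (fun j => a * x j + b * y j) = fun i => a * mulVec g x i + b * mulVec g y i := by
  ext i
  simp only [mulVec, Finset.mul_sum, ← Finset.sum_add_distrib]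
  exact Finset.sum_congr rfl fun j _ => by ring

/-- Sub-Gaussian bound for the increment of `F` along a rotation, restricted to the event that the
whole path stays in a region `K` where the gradient of `F` has squared length at most `V`. -/
lemma setLIntegral_exp_rotation_le {F : (Fin n → ℝ) → ℝ} {G : (Fin n → ℝ) → Fin n → ℝ}
    (hF : ∀ u, HasFDerivAt F
      (∑ i, G u i • (ContinuousLinearMap.proj i : (Fin n → ℝ) →L[ℝ] ℝ)) u)
    (hG : Continuous G) {K : Set (Fin n → ℝ)} (hK : MeasurableSet K) {V : ℝ}
    (hV : ∀ u ∈ K, ∑ i, G u i ^ 2 ≤ V) {x y : Fin k → ℝ} (hx : ∑ j, x j ^ 2 = 1)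
    (hy : ∑ j, y j ^ 2 = 1) (hxy : ∑ j, x j * y j = 0) (θ l : ℝ)
    {A : Set (Fin n → Fin k → ℝ)} (hA : MeasurableSet A)
    (hAK : ∀ g ∈ A, ∀ s : ℝ, mulVec g (fun j => Real.cos s * x j + Real.sin s * y j) ∈ K) :
    ∫⁻ g in A, ENNReal.ofReal (Real.exp (l *
        (F (mulVec g fun j => Real.cos θ * x j + Real.sin θ * y j) - F (mulVec g x))))
        ∂(gaussMatrix n k) ≤
      ENNReal.ofReal (Real.exp ((l * θ) ^ 2 * V / 2)) := by
  set X : ℝ → Fin k → ℝ := fun s j => Real.cos s * x j + Real.sin s * y j with hX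
  set Y : ℝ → Fin k → ℝ := fun s j => -Real.sin s * x j + Real.cos s * y j with hY
  have hXX : ∀ s, ∑ j, X s j ^ 2 = 1 := by
    intro s
    have : ∀ j, X s j ^ 2 = Real.cos s ^ 2 * x j ^ 2 + 2 * Real.cos s * Real.sin s * (x j * y j)
      + Real.sin s ^ 2 * y j ^ 2 := fun j => by simp only [hX]; ring
    simp_rw [this, Finset.sum_add_distrib, ← Finset.mul_sum, hx, hy, hxy]
    linarith [Real.sin_sq_add_cos_sq s]
  have hYY : ∀ s, ∑ j, Y s j ^ 2 = 1 := by
    intro s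
    have : ∀ j, Y s j ^ 2 = Real.sin s ^ 2 * x j ^ 2 - 2 * Real.cos s * Real.sin s * (x j * y j)
      + Real.cos s ^ 2 * y j ^ 2 := fun j => by simp only [hY]; ring
    simp_rw [this, Finset.sum_add_distrib, Finset.sum_sub_distrib, ← Finset.mul_sum, hx, hy, hxy]
    linarith [Real.sin_sq_add_cos_sq s]
  have hXY : ∀ s, ∑ j, X s j * Y s j = 0 := by
    intro s
    have : ∀ j, X s j * Y s j = -(Real.cos s * Real.sin s) * x j ^ 2 +
      (Real.cos s ^ 2 - Real.sin s ^ 2) * (x j * y j)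
      + (Real.cos s * Real.sin s) * y j ^ 2 := fun j => by simp only [hX, hY]; ring
    simp_rw [this, Finset.sum_add_distrib, ← Finset.mul_sum, hx, hy, hxy]
    ring
  have hUd : ∀ g : Fin n → Fin k → ℝ, ∀ s, HasDerivAt (fun s => mulVec g (X (θ * s)))
      (fun i => θ * mulVec g (Y (θ * s)) i) s := by
    intro g s
    rw [hasDerivAt_pi]
    intro i
    have e1 : (fun s => mulVec g (X (θ * s)) i) =
        fun s => Real.cos (θ * s) * mulVec g x i + Real.sin (θ * s) * mulVec g y i := by
      ext s; exact congrFun (mulVec_linear_comb g x y _ _) i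
    have e2 : mulVec g (Y (θ * s)) i =
        -Real.sin (θ * s) * mulVec g x i + Real.cos (θ * s) * mulVec g y i :=
      congrFun (mulVec_linear_comb g x y _ _) i
    rw [e1, e2]
    have ht : HasDerivAt (fun s : ℝ => θ * s) θ s := by
      simpa using (hasDerivAt_id s).const_mul θ
    convert! (ht.cos.mul_const (mulVec g x i)).add (ht.sin.mul_const (mulVec g y i)) using 1
    ring
  have hc : Continuous fun z : (Fin n → Fin k → ℝ) × ℝ =>
      ∑ i, G (mulVec z.1 (X (θ * z.2))) i * mulVec z.1 (Y (θ * z.2)) i := by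
    have hcX : Continuous fun z : (Fin n → Fin k → ℝ) × ℝ => mulVec z.1 (X (θ * z.2)) := by
      refine continuous_mulVec.comp (continuous_fst.prodMk ?_)
      show Continuous fun z : (Fin n → Fin k → ℝ) × ℝ => fun j =>
        Real.cos (θ * z.2) * x j + Real.sin (θ * z.2) * y j
      fun_prop
    have hcY : Continuous fun z : (Fin n → Fin k → ℝ) × ℝ => mulVec z.1 (Y (θ * z.2)) := by
      refine continuous_mulVec.comp (continuous_fst.prodMk ?_)
      show Continuous fun z : (Fin n → Fin k → ℝ) × ℝ => fun j =>
        -Real.sin (θ * z.2) * x j + Real.cos (θ * z.2) * y j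
      fun_prop
    exact continuous_finsetSum _ fun i _ => ((continuous_apply i).comp (hG.comp hcX)).mul
      ((continuous_apply i).comp hcY)
  have hfd : ∀ g : Fin n → Fin k → ℝ, ∀ s, HasDerivAt (fun s => F (mulVec g (X (θ * s))))
      (θ * ∑ i, G (mulVec g (X (θ * s))) i * mulVec g (Y (θ * s)) i) s := by
    intro g s
    have h := (hF (mulVec g (X (θ * s)))).comp_hasDerivAt s (hUd g s)
    refine h.congr_deriv ?_
    simp only [sum_apply, smul_apply,
      ContinuousLinearMap.proj_apply, smul_eq_mul, Finset.mul_sum]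
    exact Finset.sum_congr rfl fun i _ => by ring
  have hX0 : X (θ * 0) = x := by ext j; simp [hX]
  set Φ : (Fin n → Fin k → ℝ) → ℝ → ENNReal := fun g s =>
    K.indicator 1 (mulVec g (X (θ * s))) * ENNReal.ofReal (Real.exp (l * θ *
      ∑ i, G (mulVec g (X (θ * s))) i * mulVec g (Y (θ * s)) i)) with hΦ
  have hΦm : Measurable (Function.uncurry Φ) := by
    have hcX : Continuous fun z : (Fin n → Fin k → ℝ) × ℝ => mulVec z.1 (X (θ * z.2)) := by
      refine continuous_mulVec.comp (continuous_fst.prodMk ?_)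
      show Continuous fun z : (Fin n → Fin k → ℝ) × ℝ => fun j =>
        Real.cos (θ * z.2) * x j + Real.sin (θ * z.2) * y j
      fun_prop
    refine Measurable.mul ((measurable_one.indicator hK).comp hcX.measurable) ?_
    exact ENNReal.measurable_ofReal.comp
      (Real.continuous_exp.comp (continuous_const.mul hc)).measurable
  calc _ ≤ ∫⁻ g in A, (∫⁻ s in Set.Ioc (0 : ℝ) 1, Φ g s) ∂(gaussMatrix n k) := by
        refine setLIntegral_mono' hA fun g hg => ?_
        have h := ofReal_exp_sub_le_lintegral (hfd g)
          (continuous_const.mul (hc.comp (Continuous.prodMk_right g))) l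
        rw [mul_one, hX0] at h
        refine h.trans_eq (lintegral_congr fun s => ?_)
        simp only [hΦ, Set.indicator_of_mem (hAK g hg (θ * s)), Pi.one_apply, one_mul, mul_assoc, hX]
    _ ≤ ∫⁻ g, (∫⁻ s in Set.Ioc (0 : ℝ) 1, Φ g s) ∂(gaussMatrix n k) := setLIntegral_le_lintegral _ _
    _ = ∫⁻ s in Set.Ioc (0 : ℝ) 1, ∫⁻ g, Φ g s ∂(gaussMatrix n k) :=
        lintegral_lintegral_swap hΦm.aemeasurable
    _ ≤ ∫⁻ _s in Set.Ioc (0 : ℝ) 1, ENNReal.ofReal (Real.exp ((l * θ) ^ 2 * V / 2)) := by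
        refine lintegral_mono fun s => ?_
        have hmp := measurePreserving_mulVec_pair (n := n) (hXX (θ * s)) (hYY (θ * s)) (hXY (θ * s))
        have hm : Measurable fun w : (Fin n → ℝ) × (Fin n → ℝ) => K.indicator 1 w.1 *
            ENNReal.ofReal (Real.exp (l * θ * ∑ i, G w.1 i * w.2 i)) :=
          ((measurable_one.indicator hK).comp measurable_fst).mul
            (ENNReal.measurable_ofReal.comp (Continuous.measurable (by fun_prop)))
        have := hmp.lintegral_comp hm
        exact this.trans_le (lintegral_indicator_exp_inner_le hG hK hV _)
    _ = _ := by simp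

end Rotation

section Increment

/-- The sum of `p`-th powers `∑ |u_i|^p`. -/
noncomputable def powSum {n : ℕ} (p : ℝ) (u : Fin n → ℝ) : ℝ := ∑ i, |u i| ^ p

variable {n k : ℕ}

lemma powSum_nonneg (p : ℝ) (u : Fin n → ℝ) : 0 ≤ powSum p u :=
  Finset.sum_nonneg fun _ _ => by positivity

lemma continuous_powSum {p : ℝ} (hp : 0 ≤ p) : Continuous (powSum p : (Fin n → ℝ) → ℝ) := by
  unfold powSum
  exact continuous_finsetSum _ fun i _ =>
    (continuous_abs.comp (continuous_apply i)).rpow_const fun _ => Or.inr hp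

lemma continuous_powSum_mulVec {p : ℝ} (hp : 0 ≤ p) (x : Fin k → ℝ) :
    Continuous fun g : Fin n → Fin k → ℝ => powSum p (mulVec g x) :=
  (continuous_powSum hp).comp (continuous_mulVec_const x)

lemma continuous_abs_rpow_sub_two_mul {p : ℝ} (hp : 1 < p) :
    Continuous fun x : ℝ => |x| ^ (p - 2) * x := by
  have h := (contDiff_norm_rpow (E := ℝ) hp).continuous_deriv le_rfl
  have h2 : deriv (fun x : ℝ => ‖x‖ ^ p) = fun x => p * |x| ^ (p - 2) * x :=
    funext fun x => (hasDerivAt_norm_rpow x hp).deriv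
  rw [h2] at h
  have h3 : (fun x : ℝ => |x| ^ (p - 2) * x) = fun x => p⁻¹ * (p * |x| ^ (p - 2) * x) := by
    ext x; field_simp
  rw [h3]; exact continuous_const.mul h

lemma sq_abs_rpow_sub_two_mul {p : ℝ} (hp : 1 < p) (x : ℝ) :
    (|x| ^ (p - 2) * x) ^ 2 = |x| ^ (2 * p - 2) := by
  rcases eq_or_ne x 0 with rfl | hx
  · rw [abs_zero, Real.zero_rpow (by linarith : 2 * p - 2 ≠ 0)]; simp
  · have h : 0 < |x| := abs_pos.mpr hx
    rw [mul_pow, ← sq_abs x, ← Real.rpow_natCast, ← Real.rpow_mul h.le, ← Real.rpow_natCast |x|,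
      ← Real.rpow_add h]
    congr 1; push_cast; ring

lemma hasFDerivAt_powSum {p : ℝ} (hp : 1 < p) (u : Fin n → ℝ) :
    HasFDerivAt (powSum p) (∑ i, (p * (|u i| ^ (p - 2) * u i)) •
      (ContinuousLinearMap.proj i : (Fin n → ℝ) →L[ℝ] ℝ)) u := by
  unfold powSum
  refine HasFDerivAt.fun_sum fun i _ => ?_
  have h := (hasDerivAt_abs_rpow (u i) hp).comp_hasFDerivAt u
    (ContinuousLinearMap.proj i : (Fin n → ℝ) →L[ℝ] ℝ).hasFDerivAt
  rw [← mul_assoc]; exact h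

lemma abs_rpow_le_one_add {r q : ℝ} (hr : 0 ≤ r) (hrq : r ≤ q) (x : ℝ) :
    |x| ^ r ≤ 1 + |x| ^ q := by
  rcases le_total |x| 1 with h | h
  · have := Real.rpow_le_one (abs_nonneg x) h hr
    have : 0 ≤ |x| ^ q := by positivity
    linarith
  · have := Real.rpow_le_rpow_of_exponent_le h hrq
    linarith

lemma powSum_le_add_powSum {r q : ℝ} (hr : 0 ≤ r) (hrq : r ≤ q) (u : Fin n → ℝ) :
    powSum r u ≤ n + powSum q u := by
  unfold powSum
  calc _ ≤ ∑ i, (1 + |u i| ^ q) := Finset.sum_le_sum fun i _ => abs_rpow_le_one_add hr hrq _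
    _ = _ := by simp [Finset.sum_add_distrib]

/-- `powSum q` is bounded by `B` on the image under `g` of the unit sphere. -/
def sphereBound (n k : ℕ) (q B : ℝ) : Set (Fin n → Fin k → ℝ) :=
  {g | ∀ x : Fin k → ℝ, ∑ j, x j ^ 2 = 1 → powSum q (mulVec g x) ≤ B}

lemma measurableSet_sphereBound {q : ℝ} (hq : 0 ≤ q) (B : ℝ) :
    MeasurableSet (sphereBound n k q B) := by
  have : sphereBound n k q B =
      ⋂ (x : Fin k → ℝ) (_ : ∑ j, x j ^ 2 = 1), {g | powSum q (mulVec g x) ≤ B} := by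
    ext g; simp [sphereBound]
  rw [this]
  exact (isClosed_iInter fun x => isClosed_iInter fun _ =>
    isClosed_le (continuous_powSum_mulVec hq x) continuous_const).measurableSet

lemma sum_sq_cos_sin {x y : Fin k → ℝ} (hx : ∑ j, x j ^ 2 = 1)
    (hy : ∑ j, y j ^ 2 = 1) (hxy : ∑ j, x j * y j = 0) (s : ℝ) :
    ∑ j, (Real.cos s * x j + Real.sin s * y j) ^ 2 = 1 := by
  have : ∀ j, (Real.cos s * x j + Real.sin s * y j) ^ 2 =
    Real.cos s ^ 2 * x j ^ 2 + 2 * Real.cos s * Real.sin s * (x j * y j)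
      + Real.sin s ^ 2 * y j ^ 2 := fun j => by ring
  simp_rw [this, Finset.sum_add_distrib, ← Finset.mul_sum, hx, hy, hxy]
  linarith [Real.sin_sq_add_cos_sq s]

lemma setLIntegral_exp_powSum_le_of_one_lt {p q B : ℝ} (hp : 1 < p) (hq : 2 * p - 2 ≤ q)
    {x y : Fin k → ℝ} (hx : ∑ j, x j ^ 2 = 1)
    (hy : ∑ j, y j ^ 2 = 1) (hxy : ∑ j, x j * y j = 0) (θ l : ℝ) :
    ∫⁻ g in sphereBound n k q B, ENNReal.ofReal (Real.exp (l *
        (powSum p (mulVec g fun j => Real.cos θ * x j + Real.sin θ * y j) -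
          powSum p (mulVec g x)))) ∂(gaussMatrix n k) ≤
      ENNReal.ofReal (Real.exp ((l * θ) ^ 2 * (p ^ 2 * (n + B)) / 2)) := by
  have hq0 : 0 ≤ q := by linarith
  refine setLIntegral_exp_rotation_le (G := fun u i => p * (|u i| ^ (p - 2) * u i))
    (K := {u | powSum q u ≤ B}) (hasFDerivAt_powSum hp) ?_
    (isClosed_le (continuous_powSum hq0) continuous_const).measurableSet ?_ hx hy hxy θ l
    (measurableSet_sphereBound hq0 B) ?_
  · exact continuous_pi fun i => continuous_const.mul
      ((continuous_abs_rpow_sub_two_mul hp).comp (continuous_apply i))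
  · intro u hu
    simp_rw [mul_pow p, sq_abs_rpow_sub_two_mul hp, ← Finset.mul_sum]
    gcongr
    exact (powSum_le_add_powSum (by linarith) hq u).trans (by gcongr; exact hu)
  · intro g hg s
    exact hg _ (sum_sq_cos_sin hx hy hxy s)

lemma continuous_powSum_exponent (u : Fin n → ℝ) {p : ℝ} (hp : 0 < p) :
    ContinuousAt (fun r => powSum r u) p := by
  unfold powSum
  refine tendsto_finsetSum _ fun i _ => ?_
  exact (Real.continuousAt_const_rpow' hp.ne')

lemma setLIntegral_exp_powSum_le {p q B : ℝ} (hp : 1 ≤ p) (hq2 : 2 ≤ q) (hq : 2 * p - 2 ≤ q)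
    {x y : Fin k → ℝ} (hx : ∑ j, x j ^ 2 = 1)
    (hy : ∑ j, y j ^ 2 = 1) (hxy : ∑ j, x j * y j = 0) (θ l : ℝ) :
    ∫⁻ g in sphereBound n k q B, ENNReal.ofReal (Real.exp (l *
        (powSum p (mulVec g fun j => Real.cos θ * x j + Real.sin θ * y j) -
          powSum p (mulVec g x)))) ∂(gaussMatrix n k) ≤
      ENNReal.ofReal (Real.exp ((l * θ) ^ 2 * (p ^ 2 * (n + B)) / 2)) := by
  rcases hp.lt_or_eq with hp1 | rfl
  · exact setLIntegral_exp_powSum_le_of_one_lt hp1 hq hx hy hxy θ l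
  set r : ℕ → ℝ := fun m => 1 + 1 / ((m : ℝ) + 1) with hr
  have hrt : Filter.Tendsto r Filter.atTop (nhds 1) := by
    simpa [hr] using tendsto_one_div_add_atTop_nhds_zero_nat.const_add (1 : ℝ)
  have hr1 : ∀ m, 1 < r m := fun m => by
    have : (0 : ℝ) < 1 / ((m : ℝ) + 1) := by positivity
    simp only [hr]; linarith
  have hr2 : ∀ m, 2 * r m - 2 ≤ q := fun m => by
    have : 1 / ((m : ℝ) + 1) ≤ 1 := by
      rw [div_le_one (by positivity)]; linarith [(Nat.cast_nonneg m : (0 : ℝ) ≤ m)]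
    simp only [hr]; linarith
  set f : ℝ → (Fin n → Fin k → ℝ) → ENNReal := fun s g => ENNReal.ofReal (Real.exp (l *
        (powSum s (mulVec g fun j => Real.cos θ * x j + Real.sin θ * y j) -
          powSum s (mulVec g x)))) with hf
  have hfm : ∀ m, Measurable (f (r m)) := fun m => by
    refine ENNReal.measurable_ofReal.comp (Continuous.measurable ?_)
    have := (zero_lt_one.trans (hr1 m)).le
    exact Real.continuous_exp.comp (continuous_const.mul
      ((continuous_powSum_mulVec this _).sub (continuous_powSum_mulVec this _)))
  have hft : ∀ g, Filter.Tendsto (fun m => f (r m) g) Filter.atTop (nhds (f 1 g)) := fun g => by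
    have h : ContinuousAt (fun s => f s g) 1 := by
      refine ENNReal.continuous_ofReal.continuousAt.comp
        (Real.continuous_exp.continuousAt.comp (continuousAt_const.mul
          ((continuous_powSum_exponent _ one_pos).sub (continuous_powSum_exponent _ one_pos))))
    exact h.tendsto.comp hrt
  have hbt : Filter.Tendsto (fun m => ENNReal.ofReal (Real.exp ((l * θ) ^ 2 *
      (r m ^ 2 * (n + B)) / 2))) Filter.atTop
      (nhds (ENNReal.ofReal (Real.exp ((l * θ) ^ 2 * (1 ^ 2 * (n + B)) / 2)))) := by
    have h : Continuous fun s : ℝ => ENNReal.ofReal (Real.exp ((l * θ) ^ 2 *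
      (s ^ 2 * (n + B)) / 2)) := ENNReal.continuous_ofReal.comp (by fun_prop)
    exact (h.tendsto 1).comp hrt
  calc ∫⁻ g in sphereBound n k q B, f 1 g ∂(gaussMatrix n k)
      = ∫⁻ g in sphereBound n k q B, Filter.liminf (fun m => f (r m) g) Filter.atTop
          ∂(gaussMatrix n k) := lintegral_congr fun g => (hft g).liminf_eq.symm
    _ ≤ Filter.liminf (fun m => ∫⁻ g in sphereBound n k q B, f (r m) g ∂(gaussMatrix n k))
          Filter.atTop := lintegral_liminf_le hfm
    _ ≤ Filter.liminf (fun m => ENNReal.ofReal (Real.exp ((l * θ) ^ 2 *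
          (r m ^ 2 * (n + B)) / 2))) Filter.atTop :=
        Filter.liminf_le_liminf (Filter.Eventually.of_forall fun m =>
          setLIntegral_exp_powSum_le_of_one_lt (hr1 m) (hr2 m) hx hy hxy θ l)
    _ = _ := hbt.liminf_eq

/-- Chernoff's bound on an event on which the moment generating function is sub-Gaussian. -/
lemma measure_inter_ge_le_exp {Ω : Type*} [MeasurableSpace Ω] {μ : Measure Ω} {A : Set Ω}
    (hA : MeasurableSet A) {f : Ω → ℝ} (hf : Measurable f) {v : ℝ} (hv : 0 < v)
    (h : ∀ l : ℝ, ∫⁻ ω in A, ENNReal.ofReal (Real.exp (l * f ω)) ∂μ ≤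
      ENNReal.ofReal (Real.exp (l ^ 2 * v / 2))) {t : ℝ} (ht : 0 ≤ t) :
    μ (A ∩ {ω | t ≤ f ω}) ≤ ENNReal.ofReal (Real.exp (-t ^ 2 / (2 * v))) := by
  set l := t / v with hl
  have hl0 : 0 ≤ l := by positivity
  have hm : Measurable fun ω => ENNReal.ofReal (Real.exp (l * f ω)) := by fun_prop
  have h1 := mul_meas_ge_le_lintegral (μ := μ.restrict A) hm (ENNReal.ofReal (Real.exp (l * t)))
  have h2 : μ (A ∩ {ω | t ≤ f ω}) ≤
      μ.restrict A {ω | ENNReal.ofReal (Real.exp (l * t)) ≤ ENNReal.ofReal (Real.exp (l * f ω))} := by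
    rw [Measure.restrict_apply' hA, Set.inter_comm]
    refine measure_mono (Set.inter_subset_inter_left _ fun ω hω => ?_)
    exact ENNReal.ofReal_le_ofReal (Real.exp_le_exp.mpr (mul_le_mul_of_nonneg_left hω hl0))
  have h3 := (mul_le_mul_right h2 (ENNReal.ofReal (Real.exp (l * t)))).trans (h1.trans (h l))
  have h4 : ENNReal.ofReal (Real.exp (l ^ 2 * v / 2)) =
      ENNReal.ofReal (Real.exp (l * t)) * ENNReal.ofReal (Real.exp (-t ^ 2 / (2 * v))) := by
    rw [← ENNReal.ofReal_mul (Real.exp_pos _).le, ← Real.exp_add]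
    congr 2
    rw [hl]; field_simp; ring
  rw [h4] at h3
  exact (ENNReal.mul_le_mul_iff_right (by simp [Real.exp_pos]) ENNReal.ofReal_ne_top).mp h3

lemma exists_geodesic {x y : Fin k → ℝ} (hx : ∑ j, x j ^ 2 = 1) (hy : ∑ j, y j ^ 2 = 1)
    (hne : y ≠ x) (hne' : y ≠ -x) : ∃ (z : Fin k → ℝ) (θ : ℝ), ∑ j, z j ^ 2 = 1 ∧
      ∑ j, x j * z j = 0 ∧ (y = fun j => Real.cos θ * x j + Real.sin θ * z j) ∧ 0 < θ ∧
      θ ^ 2 ≤ 5 / 2 * ∑ j, (x j - y j) ^ 2 := by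
  set c := ∑ j, x j * y j with hc
  have hsub : ∑ j, (x j - y j) ^ 2 = 2 - 2 * c := by
    have : ∀ j, (x j - y j) ^ 2 = x j ^ 2 - 2 * (x j * y j) + y j ^ 2 := fun j => by ring
    simp_rw [this, Finset.sum_add_distrib, Finset.sum_sub_distrib, ← Finset.mul_sum, hx, hy]
    ring
  have hadd : ∑ j, (x j + y j) ^ 2 = 2 + 2 * c := by
    have : ∀ j, (x j + y j) ^ 2 = x j ^ 2 + 2 * (x j * y j) + y j ^ 2 := fun j => by ring
    simp_rw [this, Finset.sum_add_distrib, ← Finset.mul_sum, hx, hy]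
    ring
  have hpos : ∀ w : Fin k → ℝ, w ≠ 0 → 0 < ∑ j, w j ^ 2 := by
    intro w hw
    obtain ⟨j, hj⟩ := Function.ne_iff.mp hw
    exact Finset.sum_pos' (fun _ _ => sq_nonneg _)
      ⟨j, Finset.mem_univ _, by have : w j ≠ 0 := hj; positivity⟩
  have hc1 : c < 1 := by
    have := hpos (x - y) (sub_ne_zero.mpr hne.symm)
    simp only [Pi.sub_apply] at this
    linarith
  have hc2 : -1 < c := by
    have := hpos (x + y) (fun h => hne' (eq_neg_of_add_eq_zero_right h))
    simp only [Pi.add_apply] at this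
    linarith
  set θ := Real.arccos c with hθ
  have hcos : Real.cos θ = c := Real.cos_arccos hc2.le hc1.le
  have hθ0 : 0 < θ := Real.arccos_pos.mpr hc1
  have hθπ : θ ≤ Real.pi := Real.arccos_le_pi c
  have hsin2 : Real.sin θ ^ 2 = 1 - c ^ 2 := by
    have := Real.sin_sq_add_cos_sq θ; rw [hcos] at this; linarith
  have hs : Real.sin θ ≠ 0 := by
    intro h; rw [h] at hsin2; nlinarith
  refine ⟨fun j => (y j - c * x j) / Real.sin θ, θ, ?_, ?_, ?_, hθ0, ?_⟩
  · simp_rw [div_pow, ← Finset.sum_div]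
    have : ∀ j, (y j - c * x j) ^ 2 = y j ^ 2 - 2 * c * (x j * y j) + c ^ 2 * x j ^ 2 :=
      fun j => by ring
    simp_rw [this, Finset.sum_add_distrib, Finset.sum_sub_distrib, ← Finset.mul_sum, hx, hy,
      ← hc, hsin2]
    rw [div_eq_one_iff_eq (by nlinarith)]; ring
  · have : ∀ j, x j * ((y j - c * x j) / Real.sin θ) =
      (x j * y j - c * x j ^ 2) / Real.sin θ := fun j => by ring
    simp_rw [this, ← Finset.sum_div, Finset.sum_sub_distrib, ← Finset.mul_sum, hx, ← hc]
    simp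
  · ext j; rw [hcos]; field_simp; ring
  · have h1 : 2 / Real.pi * (θ / 2) ≤ Real.sin (θ / 2) :=
      Real.mul_le_sin (by linarith) (by linarith)
    have h2 : c = 1 - 2 * Real.sin (θ / 2) ^ 2 := by
      rw [← hcos]; conv_lhs => rw [show θ = 2 * (θ / 2) by ring, Real.cos_two_mul]
      linarith [Real.sin_sq_add_cos_sq (θ / 2)]
    have h3 : 2 / Real.pi * (θ / 2) = θ / Real.pi := by ring
    rw [h3] at h1
    have h4 : (θ / Real.pi) ^ 2 ≤ Real.sin (θ / 2) ^ 2 :=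
      pow_le_pow_left₀ (by positivity) h1 2
    rw [div_pow, div_le_iff₀ (by positivity)] at h4
    have h5 : Real.pi ^ 2 ≤ 10 := by nlinarith [Real.pi_lt_d2, Real.pi_pos]
    rw [hsub, h2]
    nlinarith [sq_nonneg (Real.sin (θ / 2))]

lemma powSum_mulVec_neg (p : ℝ) (g : Fin n → Fin k → ℝ) (x : Fin k → ℝ) :
    powSum p (mulVec g (-x)) = powSum p (mulVec g x) := by
  unfold powSum mulVec
  simp

lemma measure_powSum_increment_le {p q B : ℝ} (hp : 1 ≤ p) (hq2 : 2 ≤ q) (hq : 2 * p - 2 ≤ q)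
    {V : ℝ} (hV0 : 0 < V) (hV : p ^ 2 * (n + B) ≤ V)
    {x y : Fin k → ℝ} (hx : ∑ j, x j ^ 2 = 1) (hy : ∑ j, y j ^ 2 = 1) {d : ℝ}
    (hxy : ∑ j, (x j - y j) ^ 2 ≤ d ^ 2) {t : ℝ} (ht : 0 < t) :
    gaussMatrix n k (sphereBound n k q B ∩
      {g | t ≤ powSum p (mulVec g y) - powSum p (mulVec g x)}) ≤
      ENNReal.ofReal (Real.exp (-t ^ 2 / (5 * d ^ 2 * V))) := by
  by_cases h : y = x ∨ y = -x
  · have : ∀ g : Fin n → Fin k → ℝ, powSum p (mulVec g y) = powSum p (mulVec g x) := by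
      intro g
      rcases h with rfl | rfl
      · rfl
      · exact powSum_mulVec_neg p g x
    simp [this, not_le.mpr ht]
  · push Not at h
    obtain ⟨z, θ, hz, hxz, hyz, hθ, hθd⟩ := exists_geodesic hx hy h.1 h.2
    have hp0 : 0 ≤ p := by linarith
    have hv : θ ^ 2 * V ≤ 5 / 2 * d ^ 2 * V := by
      gcongr; linarith
    have h1 := measure_inter_ge_le_exp (μ := gaussMatrix n k) (v := θ ^ 2 * V)
      (measurableSet_sphereBound (n := n) (k := k) (by linarith : 0 ≤ q) B)
      (f := fun g => powSum p (mulVec g y) - powSum p (mulVec g x))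
      ((continuous_powSum_mulVec hp0 _).sub (continuous_powSum_mulVec hp0 _)).measurable
      (by positivity) (fun l => by
        rw [hyz]
        refine (setLIntegral_exp_powSum_le hp hq2 hq hx hz hxz θ l).trans ?_
        refine ENNReal.ofReal_le_ofReal (Real.exp_le_exp.mpr ?_)
        rw [mul_pow, mul_assoc (l ^ 2)]
        gcongr) ht.le
    refine h1.trans (ENNReal.ofReal_le_ofReal (Real.exp_le_exp.mpr ?_))
    rw [neg_div, neg_div, neg_le_neg_iff]
    exact div_le_div_of_nonneg_left (sq_nonneg t) (by positivity) (by linarith)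

end Increment

section Net

variable {k : ℕ}

lemma card_le_of_separated_closedBall {δ : ℝ} (hδ : 0 < δ) (s : Finset (EuclideanSpace ℝ (Fin k)))
    (hs : ∀ c ∈ s, ‖c‖ ≤ 1) (h : ∀ c ∈ s, ∀ d ∈ s, c ≠ d → δ ≤ ‖c - d‖) :
    (s.card : ℝ) ≤ (1 + 2 / δ) ^ k := by
  let μ : Measure (EuclideanSpace ℝ (Fin k)) := volume
  have hd2 : 0 < δ / 2 := by positivity
  have hρ : 0 < 1 + δ / 2 := by positivity
  have hdisj : (s : Set (EuclideanSpace ℝ (Fin k))).Pairwise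
      (Function.onFun Disjoint fun c => Metric.ball c (δ / 2)) := by
    intro c hc d hd hcd
    apply Metric.ball_disjoint_ball
    rw [dist_eq_norm]
    linarith [h c hc d hd hcd]
  have hsub : (⋃ c ∈ s, Metric.ball c (δ / 2)) ⊆ Metric.ball 0 (1 + δ / 2) := by
    refine Set.iUnion₂_subset fun x hx => Metric.ball_subset_ball' ?_
    rw [dist_zero_right]; linarith [hs x hx]
  have hmain : (s.card : ENNReal) * ENNReal.ofReal ((δ / 2) ^ k) * μ (Metric.ball 0 1) ≤
      ENNReal.ofReal ((1 + δ / 2) ^ k) * μ (Metric.ball 0 1) := by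
    calc _ = μ (⋃ c ∈ s, Metric.ball c (δ / 2)) := by
          rw [measure_biUnion_finset hdisj fun c _ => measurableSet_ball]
          simp only [μ.addHaar_ball_of_pos _ hd2, Finset.sum_const, nsmul_eq_mul, mul_assoc,
            finrank_euclideanSpace, Fintype.card_fin]
      _ ≤ μ (Metric.ball 0 (1 + δ / 2)) := measure_mono hsub
      _ = _ := by
          simp only [μ.addHaar_ball_of_pos _ hρ, finrank_euclideanSpace, Fintype.card_fin]
  have h1 := (ENNReal.mul_le_mul_iff_left (Metric.measure_ball_pos μ _ zero_lt_one).ne'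
    measure_ball_lt_top.ne).1 hmain
  have h2 := ENNReal.toReal_le_of_le_ofReal (by positivity) h1
  rw [ENNReal.toReal_mul, ENNReal.toReal_natCast, ENNReal.toReal_ofReal (by positivity),
    ← le_div_iff₀ (by positivity), ← div_pow] at h2
  refine h2.trans_eq ?_
  congr 1
  field_simp
  ring

lemma exists_sphere_net (k : ℕ) {δ : ℝ} (hδ : 0 < δ) : ∃ N : Finset (Fin k → ℝ),
    (∀ y ∈ N, ∑ j, y j ^ 2 = 1) ∧
    (∀ x : Fin k → ℝ, ∑ j, x j ^ 2 = 1 → ∃ y ∈ N, ∑ j, (x j - y j) ^ 2 ≤ δ ^ 2) ∧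
    (N.card : ℝ) ≤ (1 + 2 / δ) ^ k := by
  classical
  let P : ℕ → Prop := fun m => ∃ N : Finset (Fin k → ℝ), N.card = m ∧
    (∀ y ∈ N, ∑ j, y j ^ 2 = 1) ∧ ∀ c ∈ N, ∀ d ∈ N, c ≠ d → δ ^ 2 ≤ ∑ j, (c j - d j) ^ 2
  have hcard : ∀ N : Finset (Fin k → ℝ), (∀ y ∈ N, ∑ j, y j ^ 2 = 1) →
      (∀ c ∈ N, ∀ d ∈ N, c ≠ d → δ ^ 2 ≤ ∑ j, (c j - d j) ^ 2) →
      (N.card : ℝ) ≤ (1 + 2 / δ) ^ k := by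
    intro N h1 h2
    have := card_le_of_separated_closedBall hδ (N.map (WithLp.equiv 2 (Fin k → ℝ)).symm.toEmbedding)
      (by
        intro c hc
        obtain ⟨y, hy, rfl⟩ := Finset.mem_map.mp hc
        rw [EuclideanSpace.norm_eq]
        exact Real.sqrt_le_iff.mpr ⟨zero_le_one, by simpa using (h1 y hy).le⟩)
      (by
        intro c hc d hd hcd
        obtain ⟨y, hy, rfl⟩ := Finset.mem_map.mp hc
        obtain ⟨z, hz, rfl⟩ := Finset.mem_map.mp hd
        rw [EuclideanSpace.norm_eq]
        refine Real.le_sqrt_of_sq_le ?_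
        simpa using h2 y hy z hz (fun h => hcd (by rw [h])))
    simpa using this
  have hP0 : P 0 := ⟨∅, by simp⟩
  set b := ⌊(1 + 2 / δ) ^ k⌋₊ with hb
  obtain ⟨N, hN, h1, h2⟩ : P (@Nat.findGreatest P (Classical.decPred P) b) :=
    @Nat.findGreatest_spec 0 P (Classical.decPred P) b (Nat.zero_le _) hP0
  refine ⟨N, h1, fun x hx => ?_, hcard N h1 h2⟩
  by_contra! hcon
  have hxN : x ∉ N := fun hxN => by
    have := hcon x hxN
    simp only [sub_self] at this
    norm_num at this
    nlinarith
  have h1' : ∀ y ∈ insert x N, ∑ j, y j ^ 2 = 1 := by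
    intro y hy
    rcases Finset.mem_insert.mp hy with rfl | hy
    exacts [hx, h1 y hy]
  have h2' : ∀ c ∈ insert x N, ∀ d ∈ insert x N, c ≠ d → δ ^ 2 ≤ ∑ j, (c j - d j) ^ 2 := by
    intro c hc d hd hcd
    rcases Finset.mem_insert.mp hc with hc' | hc' <;> rcases Finset.mem_insert.mp hd with hd' | hd'
    · exact absurd (hc'.trans hd'.symm) hcd
    · rw [hc']
      exact (hcon d hd').le
    · rw [hd']
      refine (hcon c hc').le.trans_eq (Finset.sum_congr rfl fun j _ => by ring)
    · exact h2 c hc' d hd' hcd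
  have hPs : P (N.card + 1) := ⟨insert x N, Finset.card_insert_of_notMem hxN, h1', h2'⟩
  have hle : N.card + 1 ≤ b := by
    have := hcard _ h1' h2'
    rw [Finset.card_insert_of_notMem hxN] at this
    exact Nat.le_floor this
  have := @Nat.le_findGreatest (N.card + 1) P (Classical.decPred P) b hle hPs
  omega

end Net

section NormTail

variable {n k : ℕ}

lemma abs_rpow_le_exp {q : ℝ} (hq : 0 < q) (z : ℝ) :
    |z| ^ q ≤ q ^ (q / 2) * Real.exp (Real.sqrt q * |z| - q) := by
  have hs : 0 < Real.sqrt q := Real.sqrt_pos.mpr hq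
  have h1 : |z| / Real.sqrt q ≤ Real.exp (|z| / Real.sqrt q - 1) := by
    have := Real.add_one_le_exp (|z| / Real.sqrt q - 1); linarith
  have h2 := Real.rpow_le_rpow (by positivity) h1 hq.le
  rw [← Real.exp_mul, Real.div_rpow (abs_nonneg _) hs.le, div_le_iff₀ (by positivity)] at h2
  have h3 : Real.sqrt q ^ q = q ^ (q / 2) := by
    rw [Real.sqrt_eq_rpow, ← Real.rpow_mul hq.le]; congr 1; ring
  have h4 : (|z| / Real.sqrt q - 1) * q = Real.sqrt q * |z| - q := by
    rw [sub_mul, one_mul, div_mul_eq_mul_div]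
    congr 1
    rw [div_eq_iff hs.ne']
    linear_combination -|z| * Real.mul_self_sqrt hq.le
  rw [h3, h4] at h2
  linarith

lemma lintegral_exp_mul_gaussian (s : ℝ) :
    ∫⁻ z, ENNReal.ofReal (Real.exp (s * z)) ∂(gaussianReal 0 1) =
      ENNReal.ofReal (Real.exp (s ^ 2 / 2)) := by
  rw [← ofReal_integral_eq_lintegral_ofReal (integrable_exp_mul_gaussianReal s)
    (Filter.Eventually.of_forall fun v => (Real.exp_pos _).le)]
  have := congrFun (mgf_id_gaussianReal (μ := 0) (v := 1)) s
  congr 1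
  simpa [mgf] using this

lemma lintegral_abs_rpow_gaussian_le {q : ℝ} (hq : 0 < q) :
    ∫⁻ z, ENNReal.ofReal (|z| ^ q) ∂(gaussianReal 0 1) ≤ ENNReal.ofReal (2 * q ^ (q / 2)) := by
  set s := Real.sqrt q
  have hs2 : s ^ 2 = q := Real.sq_sqrt hq.le
  have hpt : ∀ z : ℝ, ENNReal.ofReal (|z| ^ q) ≤ ENNReal.ofReal (q ^ (q / 2) * Real.exp (-q)) *
      (ENNReal.ofReal (Real.exp (s * z)) + ENNReal.ofReal (Real.exp (-s * z))) := by
    intro z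
    rw [← ENNReal.ofReal_add (Real.exp_pos _).le (Real.exp_pos _).le,
      ← ENNReal.ofReal_mul (by positivity)]
    refine ENNReal.ofReal_le_ofReal ((abs_rpow_le_exp hq z).trans ?_)
    rw [sub_eq_add_neg, Real.exp_add, mul_comm (Real.exp (_ * _)), ← mul_assoc]
    gcongr
    rcases abs_cases z with ⟨h, _⟩ | ⟨h, _⟩ <;> rw [h]
    · linarith [Real.exp_pos (-s * z)]
    · rw [mul_neg, ← neg_mul]; linarith [Real.exp_pos (s * z)]
  refine (lintegral_mono hpt).trans ?_
  rw [lintegral_const_mul _ (by fun_prop), lintegral_add_left (by fun_prop),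
    lintegral_exp_mul_gaussian, lintegral_exp_mul_gaussian, neg_sq, hs2,
    ← ENNReal.ofReal_add (Real.exp_pos _).le (Real.exp_pos _).le,
    ← ENNReal.ofReal_mul (by positivity)]
  refine ENNReal.ofReal_le_ofReal ?_
  have : Real.exp (-q) * Real.exp (q / 2) ≤ 1 := by
    rw [← Real.exp_add, Real.exp_le_one_iff]; linarith
  have h0 : 0 < q ^ (q / 2) := by positivity
  nlinarith

lemma lintegral_powSum_le {q : ℝ} (hq : 0 < q) :
    ∫⁻ u, ENNReal.ofReal (powSum q u) ∂(_root_.stdGaussian n) ≤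
      ENNReal.ofReal (2 * (n * q ^ (q / 2))) := by
  have h1 : ∀ u : Fin n → ℝ, ENNReal.ofReal (powSum q u) = ∑ i, ENNReal.ofReal (|u i| ^ q) :=
    fun u => ENNReal.ofReal_sum_of_nonneg fun _ _ => by positivity
  simp_rw [h1]
  rw [lintegral_finsetSum _ fun i _ => by fun_prop]
  have h2 : ∀ i : Fin n, ∫⁻ u, ENNReal.ofReal (|u i| ^ q) ∂(_root_.stdGaussian n) ≤
      ENNReal.ofReal (2 * q ^ (q / 2)) := by
    intro i
    have := (measurePreserving_eval (fun _ : Fin n => gaussianReal 0 1) i).lintegral_comp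
      (f := fun z => ENNReal.ofReal (|z| ^ q)) (by fun_prop)
    exact this.trans_le (lintegral_abs_rpow_gaussian_le hq)
  refine (Finset.sum_le_sum fun i _ => h2 i).trans ?_
  rw [Finset.sum_const, Finset.card_univ, Fintype.card_fin, nsmul_eq_mul, ← ENNReal.ofReal_natCast,
    ← ENNReal.ofReal_mul (by positivity)]
  exact ENNReal.ofReal_le_ofReal (by linarith)

lemma half_le_measure_powSum_le (hn : 0 < n) {q : ℝ} (hq : 0 < q) :
    1 / 2 ≤ _root_.stdGaussian n {u | powSum q u ≤ 4 * (n * q ^ (q / 2))} := by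
  have hm : MeasurableSet {u : Fin n → ℝ | powSum q u ≤ 4 * (n * q ^ (q / 2))} :=
    (isClosed_le (continuous_powSum hq.le) continuous_const).measurableSet
  have hpos : (0 : ℝ) < n * q ^ (q / 2) := by positivity
  have h1 := meas_ge_le_lintegral_div (μ := _root_.stdGaussian n)
    (f := fun u => ENNReal.ofReal (powSum q u))
    (ENNReal.measurable_ofReal.comp (continuous_powSum hq.le).measurable).aemeasurable
    (ε := ENNReal.ofReal (4 * (n * q ^ (q / 2)))) (by rw [ne_eq, ENNReal.ofReal_eq_zero, not_le]; linarith)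
    ENNReal.ofReal_ne_top
  have h2 : _root_.stdGaussian n {u | powSum q u ≤ 4 * (n * q ^ (q / 2))}ᶜ ≤ 1 / 2 := by
    refine (measure_mono fun u hu => ?_).trans (h1.trans ?_)
    · exact ENNReal.ofReal_le_ofReal (lt_of_not_ge (show ¬ powSum q u ≤ _ from hu)).le
    · refine (ENNReal.div_le_div_right (lintegral_powSum_le hq) _).trans ?_
      rw [← ENNReal.ofReal_div_of_pos (by positivity)]
      have : 2 * (n * q ^ (q / 2)) / (4 * (n * q ^ (q / 2))) = 1 / 2 := by field_simp; norm_num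
      rw [this, ENNReal.ofReal_div_of_pos (by norm_num)]
      simp
  have h3 := prob_add_prob_compl (μ := _root_.stdGaussian n) hm
  have h4 : (1 : ENNReal) / 2 + 1 / 2 = 1 := ENNReal.add_halves 1
  by_contra! hcon
  have h5 : (1 : ENNReal) < 1 / 2 + 1 / 2 := by
    calc (1 : ENNReal) = _ := h3.symm
      _ < 1 / 2 + 1 / 2 := ENNReal.add_lt_add_of_lt_of_le (ne_top_of_le_ne_top (by simp) h2) hcon h2
  rw [h4] at h5
  exact lt_irrefl _ h5

/-- Independence of the two columns of a two-column Gaussian matrix. -/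
lemma gaussMatrix_two_apply {A B : Set (Fin n → ℝ)} (hA : MeasurableSet A) (hB : MeasurableSet B) :
    gaussMatrix n 2 {g | mulVec g (Pi.single 0 1) ∈ A ∧ mulVec g (Pi.single 1 1) ∈ B} =
      _root_.stdGaussian n A * _root_.stdGaussian n B := by
  have hmp := measurePreserving_mulVec_pair (n := n) (k := 2) (x := Pi.single 0 1)
    (y := Pi.single 1 1) (by simp) (by simp) (by simp)
  rw [← Measure.prod_prod, ← hmp.measure_preimage (hA.prod hB).nullMeasurableSet]
  rfl

/-- The smoothed `ℓ_q` norm `(1 + ∑ |u_i|^q)^{1/q}`. -/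
noncomputable def smoothNorm (q : ℝ) (u : Fin n → ℝ) : ℝ := (1 + powSum q u) ^ (1 / q)

lemma one_le_one_add_powSum (q : ℝ) (u : Fin n → ℝ) : 1 ≤ 1 + powSum q u := by
  linarith [powSum_nonneg q u]

lemma hasFDerivAt_smoothNorm {q : ℝ} (hq : 1 < q) (u : Fin n → ℝ) :
    HasFDerivAt (smoothNorm q) (∑ i, ((1 + powSum q u) ^ (1 / q - 1) * (|u i| ^ (q - 2) * u i)) •
      (ContinuousLinearMap.proj i : (Fin n → ℝ) →L[ℝ] ℝ)) u := by
  have h0 := one_le_one_add_powSum q u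
  have h := ((hasFDerivAt_powSum hq u).const_add 1).rpow_const (p := 1 / q)
    (Or.inl (by linarith : 1 + powSum q u ≠ 0))
  refine h.congr_fderiv ?_
  rw [Finset.smul_sum]
  refine Finset.sum_congr rfl fun i _ => ?_
  rw [smul_smul]
  congr 1
  field_simp

lemma continuous_smoothNorm {q : ℝ} (hq : 1 < q) :
    Continuous (smoothNorm q : (Fin n → ℝ) → ℝ) :=
  continuous_iff_continuousAt.mpr fun u => (hasFDerivAt_smoothNorm hq u).continuousAt

lemma sum_sq_gradient_smoothNorm_le {q : ℝ} (hq : 2 ≤ q) (u : Fin n → ℝ) :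
    ∑ i, ((1 + powSum q u) ^ (1 / q - 1) * (|u i| ^ (q - 2) * u i)) ^ 2 ≤ 1 := by
  have h0 := one_le_one_add_powSum q u
  have hT0 := powSum_nonneg q u
  set T := powSum q u with hT
  have hq0 : 0 < q := by linarith
  set r := (2 * q - 2) / q with hr
  have hr1 : 1 ≤ r := by rw [hr, le_div_iff₀ hq0]; linarith
  have h1 : ∀ i, |u i| ^ (2 * q - 2) ≤ |u i| ^ q * (1 + T) ^ (r - 1) := by
    intro i
    have hle : |u i| ^ q ≤ 1 + T := by
      have : |u i| ^ q ≤ T := Finset.single_le_sum (f := fun i => |u i| ^ q)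
        (fun _ _ => by positivity) (Finset.mem_univ i)
      linarith
    have he : |u i| ^ (2 * q - 2) = |u i| ^ q * (|u i| ^ q) ^ (r - 1) := by
      rw [← Real.rpow_mul (abs_nonneg _), ← Real.rpow_add_of_nonneg (abs_nonneg _) hq0.le
        (by nlinarith)]
      congr 1; rw [hr]; field_simp; ring
    rw [he]
    gcongr
  simp_rw [mul_pow _ (_ * _), sq_abs_rpow_sub_two_mul (by linarith : 1 < q), ← Finset.mul_sum]
  calc _ ≤ ((1 + T) ^ (1 / q - 1)) ^ 2 * ∑ i, |u i| ^ q * (1 + T) ^ (r - 1) := by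
        gcongr with i; exact h1 i
    _ = ((1 + T) ^ (1 / q - 1)) ^ 2 * (T * (1 + T) ^ (r - 1)) := by
        rw [← Finset.sum_mul]; rfl
    _ ≤ ((1 + T) ^ (1 / q - 1)) ^ 2 * ((1 + T) * (1 + T) ^ (r - 1)) := by
        gcongr; linarith
    _ = 1 := by
        have hp : 0 < 1 + T := by linarith
        rw [← Real.rpow_one_add' hp.le (by linarith), ← Real.rpow_natCast, ← Real.rpow_mul hp.le,
          ← Real.rpow_add hp]
        refine (congrArg ((1 + T) ^ ·) (?_ : _ = (0 : ℝ))).trans (Real.rpow_zero _)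
        rw [hr]; push_cast; field_simp; ring

lemma measure_smoothNorm_sub_ge_le {q : ℝ} (hq : 2 ≤ q) {t : ℝ} (ht : 0 ≤ t) :
    gaussMatrix n 2 {g | t ≤ smoothNorm q (mulVec g (Pi.single 1 1)) -
      smoothNorm q (mulVec g (Pi.single 0 1))} ≤ ENNReal.ofReal (Real.exp (-t ^ 2 / 5)) := by
  have hq1 : 1 < q := by linarith
  have hc : Continuous fun g : Fin n → Fin 2 → ℝ => smoothNorm q (mulVec g (Pi.single 1 1)) -
      smoothNorm q (mulVec g (Pi.single 0 1)) :=
    ((continuous_smoothNorm hq1).comp (continuous_mulVec_const _)).sub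
      ((continuous_smoothNorm hq1).comp (continuous_mulVec_const _))
  have hG : Continuous fun (u : Fin n → ℝ) i =>
      (1 + powSum q u) ^ (1 / q - 1) * (|u i| ^ (q - 2) * u i) := by
    refine continuous_pi fun i => Continuous.mul ?_
      ((continuous_abs_rpow_sub_two_mul hq1).comp (continuous_apply i))
    exact (continuous_const.add (continuous_powSum (by linarith))).rpow_const
      fun u => Or.inl (zero_lt_one.trans_le (one_le_one_add_powSum q u)).ne'
  have h := measure_inter_ge_le_exp (μ := gaussMatrix n 2) (A := Set.univ) (v := 5 / 2)
    MeasurableSet.univ hc.measurable (by norm_num) (fun l => by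
      have h1 := setLIntegral_exp_rotation_le (n := n) (k := 2) (hasFDerivAt_smoothNorm hq1) hG
        MeasurableSet.univ (fun u _ => sum_sq_gradient_smoothNorm_le hq u) (x := Pi.single 0 1)
        (y := Pi.single 1 1) (by simp) (by simp) (by simp) (Real.pi / 2) l
        MeasurableSet.univ (fun _ _ _ => Set.mem_univ _)
      simp only [Real.cos_pi_div_two, Real.sin_pi_div_two, zero_mul, one_mul, zero_add] at h1
      refine h1.trans (ENNReal.ofReal_le_ofReal (Real.exp_le_exp.mpr ?_))
      have : Real.pi ^ 2 ≤ 10 := by nlinarith [Real.pi_lt_d2, Real.pi_pos]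
      nlinarith [sq_nonneg l]) ht
  rw [Set.univ_inter] at h
  convert h using 4
  norm_num

/-- A bound for the `q`-th root of `1 + ∑ |g_i|^q` that holds with probability at least `1/2`. -/
noncomputable def typicalNorm (n : ℕ) (q : ℝ) : ℝ := (1 + 4 * (n * q ^ (q / 2))) ^ (1 / q)

lemma measure_smoothNorm_ge_le (hn : 0 < n) {q : ℝ} (hq : 2 ≤ q) {t : ℝ} (ht : 0 ≤ t) :
    _root_.stdGaussian n {u | typicalNorm n q + t ≤ smoothNorm q u} ≤
      ENNReal.ofReal (2 * Real.exp (-t ^ 2 / 5)) := by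
  have hq0 : 0 < q := by linarith
  have hA : MeasurableSet {u : Fin n → ℝ | powSum q u ≤ 4 * (n * q ^ (q / 2))} :=
    (isClosed_le (continuous_powSum hq0.le) continuous_const).measurableSet
  have hB : MeasurableSet {u : Fin n → ℝ | typicalNorm n q + t ≤ smoothNorm q u} :=
    (isClosed_le continuous_const (continuous_smoothNorm (by linarith))).measurableSet
  have h1 := gaussMatrix_two_apply hA hB
  have h2 := half_le_measure_powSum_le hn hq0
  have h3 : _root_.stdGaussian n {u | powSum q u ≤ 4 * (n * q ^ (q / 2))} *
      _root_.stdGaussian n {u | typicalNorm n q + t ≤ smoothNorm q u} ≤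
      ENNReal.ofReal (Real.exp (-t ^ 2 / 5)) := by
    rw [← h1]
    refine (measure_mono ?_).trans (measure_smoothNorm_sub_ge_le hq ht)
    rintro g ⟨ha, hb⟩
    have : smoothNorm q (mulVec g (Pi.single 0 1)) ≤ typicalNorm n q :=
      Real.rpow_le_rpow (by linarith [one_le_one_add_powSum q (mulVec g (Pi.single 0 1))])
        (by gcongr; exact ha) (by positivity)
    simp only [Set.mem_ofPred_eq] at hb ⊢
    linarith
  rw [ENNReal.ofReal_mul (by norm_num)]
  calc _ = 2 * (1 / 2 * _root_.stdGaussian n {u | typicalNorm n q + t ≤ smoothNorm q u}) := by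
        rw [← mul_assoc, one_div, ENNReal.mul_inv_cancel (by simp) (by simp), one_mul]
    _ ≤ 2 * ENNReal.ofReal (Real.exp (-t ^ 2 / 5)) := by
        gcongr; exact (mul_le_mul_left h2 _).trans h3
    _ = _ := by simp

lemma pNorm_eq_powSum_rpow (q : ℝ) (u : Fin n → ℝ) : pNorm q u = powSum q u ^ (1 / q) := rfl

lemma pNorm_add_le {q : ℝ} (hq : 1 ≤ q) (u v : Fin n → ℝ) :
    pNorm q (fun i => u i + v i) ≤ pNorm q u + pNorm q v :=
  Real.Lp_add_le _ u v hq

lemma pNorm_const_mul {q : ℝ} (hq : 1 ≤ q) {a : ℝ} (ha : 0 ≤ a) (u : Fin n → ℝ) :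
    pNorm q (fun i => a * u i) = a * pNorm q u := by
  unfold pNorm
  simp_rw [abs_mul, abs_of_nonneg ha, Real.mul_rpow ha (abs_nonneg _), ← Finset.mul_sum]
  rw [Real.mul_rpow (by positivity) (Finset.sum_nonneg fun _ _ => by positivity),
    ← Real.rpow_mul ha, mul_one_div_cancel (by linarith), Real.rpow_one]

lemma mulVec_const_mul (g : Fin n → Fin k → ℝ) (x : Fin k → ℝ) (a : ℝ) :
    mulVec g (fun j => a * x j) = fun i => a * mulVec g x i := by
  have := mulVec_linear_comb g x 0 a 0
  simpa using this

lemma mulVec_add (g : Fin n → Fin k → ℝ) (x y : Fin k → ℝ) :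
    mulVec g (fun j => x j + y j) = fun i => mulVec g x i + mulVec g y i := by
  have := mulVec_linear_comb g x y 1 1
  simpa using this

lemma mulVec_zero (g : Fin n → Fin k → ℝ) : mulVec g 0 = 0 := by
  ext i; simp [mulVec]

lemma pNorm_mulVec_bounds_of_sphere {q L R : ℝ} (hq : 1 ≤ q) {g : Fin n → Fin k → ℝ}
    (h : ∀ x : Fin k → ℝ, ∑ j, x j ^ 2 = 1 →
      L ≤ pNorm q (mulVec g x) ∧ pNorm q (mulVec g x) ≤ R) (x : Fin k → ℝ) :
    L * eucNorm x ≤ pNorm q (mulVec g x) ∧ pNorm q (mulVec g x) ≤ R * eucNorm x := by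
  rcases eq_or_ne x 0 with rfl | hx
  · have h0 : q ≠ 0 := by linarith
    have h1 : q⁻¹ ≠ 0 := inv_ne_zero h0
    simp [mulVec_zero, pNorm, eucNorm, Real.zero_rpow h0, Real.zero_rpow h1]
  · have hpos : 0 < eucNorm x := by
      obtain ⟨j, hj⟩ := Function.ne_iff.mp hx
      exact Real.sqrt_pos.mpr (Finset.sum_pos' (fun _ _ => sq_nonneg _)
        ⟨j, Finset.mem_univ _, by have : x j ≠ 0 := hj; positivity⟩)
    have hsq : eucNorm x ^ 2 = ∑ j, x j ^ 2 := Real.sq_sqrt (by positivity)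
    have h1 := h (fun j => (eucNorm x)⁻¹ * x j) (by
      simp_rw [mul_pow, ← Finset.mul_sum, ← hsq]; field_simp)
    rwa [mulVec_const_mul, pNorm_const_mul hq (by positivity), inv_mul_le_iff₀ hpos,
      le_inv_mul_iff₀ hpos, mul_comm _ L, mul_comm _ R] at h1

lemma isCompact_sphere_pi (k : ℕ) : IsCompact {x : Fin k → ℝ | ∑ j, x j ^ 2 = 1} := by
  refine (isCompact_Icc (a := fun _ : Fin k => (-1 : ℝ)) (b := fun _ => 1)).of_isClosed_subset
    (isClosed_eq (by fun_prop) continuous_const) fun x hx => ?_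
  have h : ∀ j, x j ^ 2 ≤ 1 := fun j => (Finset.single_le_sum (f := fun j => x j ^ 2)
    (fun _ _ => sq_nonneg _) (Finset.mem_univ j)).trans_eq hx
  exact ⟨fun j => by nlinarith [h j], fun j => by nlinarith [h j]⟩

lemma pNorm_mulVec_le_of_net {q R : ℝ} (hq : 1 ≤ q) {g : Fin n → Fin k → ℝ}
    {N : Finset (Fin k → ℝ)}
    (hN : ∀ x : Fin k → ℝ, ∑ j, x j ^ 2 = 1 → ∃ y ∈ N, ∑ j, (x j - y j) ^ 2 ≤ (1 / 2) ^ 2)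
    (h : ∀ y ∈ N, pNorm q (mulVec g y) ≤ R) {x : Fin k → ℝ} (hx : ∑ j, x j ^ 2 = 1) :
    pNorm q (mulVec g x) ≤ 2 * R := by
  have hc : Continuous fun x : Fin k → ℝ => pNorm q (mulVec g x) := by
    have h1 : Continuous fun x : Fin k → ℝ => mulVec g x :=
      continuous_mulVec.comp (Continuous.prodMk_right g)
    exact ((continuous_powSum (by linarith)).comp h1).rpow_const fun _ => Or.inr (by positivity)
  obtain ⟨z, hz, hmax⟩ := (isCompact_sphere_pi k).exists_isMaxOn ⟨x, hx⟩ hc.continuousOn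
  have hS : ∀ w : Fin k → ℝ, ∑ j, w j ^ 2 = 1 → pNorm q (mulVec g w) ≤ pNorm q (mulVec g z) :=
    fun w hw => hmax hw
  obtain ⟨y, hy, hzy⟩ := hN z hz
  have h1 : pNorm q (mulVec g z) ≤ pNorm q (mulVec g y) + pNorm q (mulVec g fun j => z j - y j) := by
    have : z = fun j => y j + (z j - y j) := by ext j; ring
    conv_lhs => rw [this, mulVec_add]
    exact pNorm_add_le hq _ _
  have h2 := (pNorm_mulVec_bounds_of_sphere hq
    (fun x hx => ⟨Real.rpow_nonneg (powSum_nonneg _ _) _, hS x hx⟩) fun j => z j - y j).2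
  have h3 : eucNorm (fun j => z j - y j) ≤ 1 / 2 := Real.sqrt_le_iff.mpr ⟨by norm_num, hzy⟩
  have h4 : 0 ≤ pNorm q (mulVec g z) := Real.rpow_nonneg (powSum_nonneg _ _) _
  have h5 := h y hy
  have h6 := hS x hx
  nlinarith

lemma five_pow_le_exp {D : ℝ} (hk : (k : ℝ) ≤ D) : (5 : ℝ) ^ k ≤ Real.exp (2 * D) := by
  have h5 : (5 : ℝ) ≤ Real.exp 2 := by
    have h := Real.exp_one_gt_d9
    have : Real.exp 2 = Real.exp 1 ^ 2 := by rw [← Real.exp_nat_mul]; norm_num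
    rw [this]; nlinarith
  calc (5 : ℝ) ^ k ≤ Real.exp 2 ^ k := by gcongr
    _ = Real.exp (k * 2) := by rw [← Real.exp_nat_mul]
    _ ≤ _ := Real.exp_le_exp.mpr (by linarith)

lemma typicalNorm_bound (hn : 0 < n) {q : ℝ} (hq : 2 ≤ q) {D : ℝ} (hD : 0 ≤ D) :
    (2 * (typicalNorm n q + 5 * Real.sqrt D)) ^ q ≤
      20 ^ q * (n * q ^ (q / 2) + D ^ (q / 2)) := by
  have hq0 : 0 < q := by linarith
  set W : ℝ := n * q ^ (q / 2) with hW
  have hW1 : 1 ≤ W := by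
    have h1 : (1 : ℝ) ≤ n := by exact_mod_cast hn
    have h2 : (1 : ℝ) ≤ q ^ (q / 2) := Real.one_le_rpow (by linarith) (by linarith)
    nlinarith
  have hm : 0 ≤ typicalNorm n q := by unfold typicalNorm; positivity
  have hmq : typicalNorm n q ^ q = 1 + 4 * W := by
    unfold typicalNorm
    rw [← Real.rpow_mul (by positivity), one_div_mul_cancel hq0.ne', Real.rpow_one]
  have hmax : ∀ a b : ℝ, 0 ≤ a → 0 ≤ b → (a + b) ^ q ≤ 2 ^ q * (a ^ q + b ^ q) := by
    intro a b ha hb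
    wlog hab : a ≤ b generalizing a b
    · rw [add_comm a, add_comm (a ^ q)]; exact this b a hb ha (le_of_not_ge hab)
    calc (a + b) ^ q ≤ (2 * b) ^ q := by gcongr; linarith
      _ = 2 ^ q * b ^ q := Real.mul_rpow (by norm_num) hb
      _ ≤ _ := by gcongr; linarith [Real.rpow_nonneg ha q]
  have hsD : Real.sqrt D ^ q = D ^ (q / 2) := by
    rw [Real.sqrt_eq_rpow, ← Real.rpow_mul hD]; congr 1; ring
  have h5 : (5 : ℝ) ≤ 5 ^ q := by
    conv_lhs => rw [← Real.rpow_one 5]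
    exact Real.rpow_le_rpow_of_exponent_le (by norm_num) (by linarith)
  have h20 : (20 : ℝ) ^ q = 2 ^ q * 2 ^ q * 5 ^ q := by
    rw [← Real.mul_rpow (by norm_num) (by norm_num), ← Real.mul_rpow (by norm_num) (by norm_num)]
    norm_num
  have hDq : 0 ≤ D ^ (q / 2) := by positivity
  have h2q : 0 < (2 : ℝ) ^ q := by positivity
  calc _ = 2 ^ q * (typicalNorm n q + 5 * Real.sqrt D) ^ q :=
        Real.mul_rpow (by norm_num) (by positivity)
    _ ≤ 2 ^ q * (2 ^ q * (typicalNorm n q ^ q + (5 * Real.sqrt D) ^ q)) := by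
        gcongr; exact hmax _ _ hm (by positivity)
    _ = 2 ^ q * 2 ^ q * (1 + 4 * W + 5 ^ q * D ^ (q / 2)) := by
        rw [hmq, Real.mul_rpow (by norm_num) (by positivity), hsD]; ring
    _ ≤ 2 ^ q * 2 ^ q * (5 ^ q * W + 5 ^ q * D ^ (q / 2)) := by
        gcongr; nlinarith
    _ = _ := by rw [h20]; ring

lemma measure_compl_sphereBound_le (hn : 0 < n) {q : ℝ} (hq : 2 ≤ q) {D : ℝ} (hk : (k : ℝ) ≤ D) :
    gaussMatrix n k (sphereBound n k q (20 ^ q * (n * q ^ (q / 2) + D ^ (q / 2))))ᶜ ≤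
      ENNReal.ofReal (2 * Real.exp (-(3 * D))) := by
  have hD : 0 ≤ D := (Nat.cast_nonneg k).trans hk
  have hq0 : 0 < q := by linarith
  obtain ⟨N, hN1, hN2, hNc⟩ := exists_sphere_net k (δ := 1 / 2) (by norm_num)
  norm_num at hNc
  set R := typicalNorm n q + 5 * Real.sqrt D with hR
  have hm : 0 ≤ typicalNorm n q := by unfold typicalNorm; positivity
  have hR0 : 0 ≤ R := by positivity
  have hsub : (sphereBound n k q (20 ^ q * (n * q ^ (q / 2) + D ^ (q / 2))))ᶜ ⊆
      ⋃ y ∈ N, {g | R ≤ smoothNorm q (mulVec g y)} := by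
    intro g hg
    by_contra hcon
    simp only [Set.mem_iUnion, Set.mem_ofPred_eq, not_exists, not_le] at hcon
    refine hg fun x hx => ?_
    have h1 : pNorm q (mulVec g x) ≤ 2 * R := by
      refine pNorm_mulVec_le_of_net (by linarith) (by simpa using hN2) (fun y hy => ?_) hx
      refine le_trans ?_ (hcon y hy).le
      exact Real.rpow_le_rpow (powSum_nonneg _ _) (le_add_of_nonneg_left zero_le_one) (by positivity)
    have h2 := Real.rpow_le_rpow (Real.rpow_nonneg (powSum_nonneg q (mulVec g x)) _) h1 hq0.le
    rw [← Real.rpow_mul (powSum_nonneg _ _), one_div_mul_cancel hq0.ne', Real.rpow_one] at h2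
    exact h2.trans (typicalNorm_bound hn hq hD)
  refine (measure_mono hsub).trans ((measure_biUnion_finset_le _ _).trans ?_)
  have hy : ∀ y ∈ N, gaussMatrix n k {g | R ≤ smoothNorm q (mulVec g y)} ≤
      ENNReal.ofReal (2 * Real.exp (-(5 * Real.sqrt D) ^ 2 / 5)) := by
    intro y hy
    have hB : MeasurableSet {u : Fin n → ℝ | R ≤ smoothNorm q u} :=
      (isClosed_le continuous_const (continuous_smoothNorm (by linarith))).measurableSet
    have := (measurePreserving_mulVec (n := n) (hN1 y hy)).measure_preimage hB.nullMeasurableSet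
    exact this.trans_le (measure_smoothNorm_ge_le hn hq (by positivity))
  refine (Finset.sum_le_sum hy).trans ?_
  rw [Finset.sum_const, nsmul_eq_mul, ← ENNReal.ofReal_natCast, ← ENNReal.ofReal_mul (by positivity)]
  refine ENNReal.ofReal_le_ofReal ?_
  have h1 : -(5 * Real.sqrt D) ^ 2 / 5 = -(5 * D) := by
    rw [mul_pow, Real.sq_sqrt hD]; ring
  have h2 := hNc.trans (five_pow_le_exp hk)
  rw [h1]
  calc _ ≤ Real.exp (2 * D) * (2 * Real.exp (-(5 * D))) := by gcongr
    _ = 2 * (Real.exp (2 * D) * Real.exp (-(5 * D))) := by ring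
    _ = _ := by rw [← Real.exp_add]; congr 2; ring

end NormTail

section Chaining

variable {n k : ℕ}

/-- Two independent standard Gaussian vectors are unlikely to be separated by `powSum p`. -/
lemma measure_mul_measure_le {p q : ℝ} (hp : 1 ≤ p) (hq2 : 2 ≤ q) (hq : 2 * p - 2 ≤ q)
    {B V : ℝ} (hV0 : 0 < V) (hV : p ^ 2 * (n + B) ≤ V) {t : ℝ} (ht : 0 < t)
    {A A' : Set (Fin n → ℝ)} (hA : MeasurableSet A) (hA' : MeasurableSet A')
    (h : ∀ u ∈ A, ∀ v ∈ A', t ≤ powSum p v - powSum p u) :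
    _root_.stdGaussian n A * _root_.stdGaussian n A' ≤
      gaussMatrix n 2 (sphereBound n 2 q B)ᶜ +
        ENNReal.ofReal (Real.exp (-t ^ 2 / (10 * V))) := by
  rw [← gaussMatrix_two_apply hA hA']
  have hinc := measure_powSum_increment_le (n := n) (k := 2) hp hq2 hq hV0 hV
    (x := Pi.single 0 1) (y := Pi.single 1 1) (by simp) (by simp) (d := Real.sqrt 2)
    (by rw [Real.sq_sqrt (by norm_num)]; norm_num [Fin.sum_univ_two]) ht
  rw [Real.sq_sqrt (by norm_num), show (5 : ℝ) * 2 * V = 10 * V by ring] at hinc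
  refine le_trans (measure_mono fun g hg => ?_)
    ((measure_union_le _ _).trans (add_le_add_right hinc _))
  by_cases hs : g ∈ sphereBound n 2 q B
  · exact Or.inr ⟨hs, h _ hg.1 _ hg.2⟩
  · exact Or.inl hs

lemma measure_powSum_sub_median_ge_le {p q : ℝ} (hp : 1 ≤ p) (hq2 : 2 ≤ q)
    (hq : 2 * p - 2 ≤ q) {B V : ℝ} (hV0 : 0 < V) (hV : p ^ 2 * (n + B) ≤ V) {t : ℝ} (ht : 0 < t)
    {m : ℝ} (hm : IsMedian (_root_.stdGaussian n) (powSum p) m) :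
    _root_.stdGaussian n {u | t ≤ |powSum p u - m|} ≤
      4 * (gaussMatrix n 2 (sphereBound n 2 q B)ᶜ +
        ENNReal.ofReal (Real.exp (-t ^ 2 / (10 * V)))) := by
  set b := gaussMatrix n 2 (sphereBound n 2 q B)ᶜ +
        ENNReal.ofReal (Real.exp (-t ^ 2 / (10 * V)))
  have hc := (continuous_powSum (n := n) (zero_le_one.trans hp)).measurable
  have h1 := measure_mul_measure_le (n := n) hp hq2 hq hV0 hV ht
    (A := {u | powSum p u ≤ m}) (A' := {u | m + t ≤ powSum p u})
    (measurableSet_le hc measurable_const) (measurableSet_le measurable_const hc)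
    (fun u (hu : powSum p u ≤ m) v (hv : m + t ≤ powSum p v) => by linarith)
  have h2 := measure_mul_measure_le (n := n) hp hq2 hq hV0 hV ht
    (A := {u | powSum p u ≤ m - t}) (A' := {u | m ≤ powSum p u})
    (measurableSet_le hc measurable_const) (measurableSet_le measurable_const hc)
    (fun u (hu : powSum p u ≤ m - t) v (hv : m ≤ powSum p v) => by linarith)
  have h12 : (2 : ENNReal) * (1 / 2) = 1 := ENNReal.mul_div_cancel (by norm_num) (by norm_num)
  have h1' : _root_.stdGaussian n {u | m + t ≤ powSum p u} ≤ 2 * b := by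
    calc _ = 2 * (1 / 2 * _root_.stdGaussian n {u | m + t ≤ powSum p u}) := by
          rw [← mul_assoc, h12, one_mul]
      _ ≤ 2 * b := by gcongr; exact (mul_le_mul_left hm.2 _).trans h1
  have h2' : _root_.stdGaussian n {u | powSum p u ≤ m - t} ≤ 2 * b := by
    calc _ = 2 * (_root_.stdGaussian n {u | powSum p u ≤ m - t} * (1 / 2)) := by
          rw [mul_comm _ (1 / 2), ← mul_assoc, h12, one_mul]
      _ ≤ 2 * b := by gcongr; exact (mul_le_mul_right hm.1 _).trans h2
  calc _ ≤ _root_.stdGaussian n ({u | m + t ≤ powSum p u} ∪ {u | powSum p u ≤ m - t}) := by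
        refine measure_mono fun u (hu : t ≤ _) => ?_
        rcases le_abs.mp hu with h | h
        · exact Or.inl (show m + t ≤ _ by linarith)
        · exact Or.inr (show _ ≤ m - t by linarith)
    _ ≤ 2 * b + 2 * b := (measure_union_le _ _).trans (add_le_add h1' h2')
    _ = 4 * b := by ring

/-- A sequence of finite nets of the sphere of scales `2 ^ (1 - s)`, starting from a point. -/
lemma exists_sphere_nets {e : Fin k → ℝ} (he : ∑ j, e j ^ 2 = 1) :
    ∃ N : ℕ → Finset (Fin k → ℝ), N 0 = {e} ∧ (∀ s, ∀ y ∈ N s, ∑ j, y j ^ 2 = 1) ∧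
      (∀ s, ∀ x : Fin k → ℝ, ∑ j, x j ^ 2 = 1 →
        ∃ y ∈ N s, ∑ j, (x j - y j) ^ 2 ≤ (2 * (1 / 2) ^ s) ^ 2) ∧
      ∀ s, ((N s).card : ℝ) ≤ (2 ^ (s + 1)) ^ k := by
  choose N h1 h2 h3 using fun s : ℕ =>
    exists_sphere_net k (δ := 2 * (1 / 2) ^ s) (by positivity)
  refine ⟨fun s => if s = 0 then {e} else N s, by simp, fun s => ?_, fun s => ?_, fun s => ?_⟩
  · dsimp only
    split_ifs
    exacts [by simpa using he, h1 s]
  · dsimp only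
    split_ifs with hs
    · subst hs
      intro x hx
      refine ⟨e, by simp, ?_⟩
      have : ∑ j, (x j - e j) ^ 2 ≤ ∑ j, (2 * x j ^ 2 + 2 * e j ^ 2) :=
        Finset.sum_le_sum fun j _ => by nlinarith [sq_nonneg (x j + e j)]
      rw [Finset.sum_add_distrib, ← Finset.mul_sum, ← Finset.mul_sum, hx, he] at this
      norm_num at this ⊢
      exact this
    · exact h2 s
  · dsimp only
    split_ifs with hs
    · simpa using one_le_pow₀ (one_le_pow₀ (by norm_num))
    · refine (h3 s).trans ?_
      gcongr
      have : (1 : ℝ) ≤ 2 ^ s := one_le_pow₀ (by norm_num)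
      rw [pow_succ, one_div, inv_pow, mul_comm 2 (_⁻¹), div_mul_cancel_right₀ (by norm_num), inv_inv]
      linarith

lemma sum_range_succ_mul_half_pow_le (m : ℕ) :
    ∑ s ∈ Finset.range m, ((s : ℝ) + 1) * (1 / 2) ^ s ≤ 4 := by
  have : ∑ s ∈ Finset.range m, ((s : ℝ) + 1) * (1 / 2) ^ s = 4 - (2 * m + 4) * (1 / 2) ^ m := by
    induction m with
    | zero => norm_num
    | succ m ih => rw [Finset.sum_range_succ, ih]; push_cast; ring
  rw [this]
  have : (0 : ℝ) ≤ (2 * m + 4) * (1 / 2) ^ m := by positivity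
  linarith

/-- Deterministic chaining along nets of scales `2 ^ (1 - s)`. -/
lemma abs_sub_le_of_nets {e : Fin k → ℝ} {N : ℕ → Finset (Fin k → ℝ)} (hN0 : N 0 = {e})
    (hN : ∀ s, ∀ x : Fin k → ℝ, ∑ j, x j ^ 2 = 1 →
        ∃ y ∈ N s, ∑ j, (x j - y j) ^ 2 ≤ (2 * (1 / 2) ^ s) ^ 2)
    {f : (Fin k → ℝ) → ℝ} (hf : Continuous f) {τ : ℝ} (hτ : 0 ≤ τ)
    (h : ∀ s, ∀ y ∈ N s, ∀ z ∈ N (s + 1), ∑ j, (y j - z j) ^ 2 ≤ (3 * (1 / 2) ^ s) ^ 2 →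
      |f z - f y| ≤ τ * ((s + 1) * (1 / 2) ^ s))
    {x : Fin k → ℝ} (hx : ∑ j, x j ^ 2 = 1) : |f x - f e| ≤ 4 * τ := by
  choose y hyN hy using fun s => hN s x hx
  have hy0 : y 0 = e := by simpa [hN0] using hyN 0
  have hstep : ∀ s, |f (y (s + 1)) - f (y s)| ≤ τ * ((s + 1) * (1 / 2) ^ s) := by
    intro s
    refine h s _ (hyN s) _ (hyN (s + 1)) ?_
    calc ∑ j, (y s j - y (s + 1) j) ^ 2
        ≤ ∑ j, (3 / 2 * (x j - y s j) ^ 2 + 3 * (x j - y (s + 1) j) ^ 2) :=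
          Finset.sum_le_sum fun j _ => by
            nlinarith [sq_nonneg ((x j - y s j) + 2 * (x j - y (s + 1) j))]
      _ ≤ 3 / 2 * (2 * (1 / 2) ^ s) ^ 2 + 3 * (2 * (1 / 2) ^ (s + 1)) ^ 2 := by
          rw [Finset.sum_add_distrib, ← Finset.mul_sum, ← Finset.mul_sum]
          linarith [hy s, hy (s + 1)]
      _ = _ := by ring
  have hbd : ∀ m, |f (y m) - f e| ≤ 4 * τ := by
    intro m
    have h1 : |f (y m) - f e| ≤ ∑ s ∈ Finset.range m, τ * (((s : ℝ) + 1) * (1 / 2) ^ s) := by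
      rw [← hy0, ← Finset.sum_range_sub (fun s => f (y s))]
      exact (Finset.abs_sum_le_sum_abs _ _).trans (Finset.sum_le_sum fun s _ => hstep s)
    rw [← Finset.mul_sum] at h1
    nlinarith [sum_range_succ_mul_half_pow_le m]
  have hlim : Filter.Tendsto y Filter.atTop (nhds x) := by
    rw [tendsto_pi_nhds]
    intro j
    have hz : Filter.Tendsto (fun s : ℕ => 2 * (1 / 2 : ℝ) ^ s) Filter.atTop (nhds 0) := by
      simpa using (tendsto_pow_atTop_nhds_zero_of_lt_one (by norm_num : (0 : ℝ) ≤ 1 / 2)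
        (by norm_num)).const_mul 2
    rw [tendsto_iff_dist_tendsto_zero]
    refine squeeze_zero (fun _ => dist_nonneg) (fun s => ?_) hz
    rw [dist_comm, Real.dist_eq]
    refine abs_le_of_sq_le_sq ?_ (by positivity) |> fun h => h
    exact (Finset.single_le_sum (f := fun j => (x j - y s j) ^ 2)
      (fun _ _ => sq_nonneg _) (Finset.mem_univ j)).trans (hy s)
  exact le_of_tendsto (((hf.tendsto x).comp hlim).sub_const (f e)).abs
    (Filter.Eventually.of_forall hbd)

lemma two_pow_le_exp {m : ℕ} {D : ℝ} (hk : (k : ℝ) ≤ D) :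
    ((2 : ℝ) ^ m) ^ k ≤ Real.exp (m * D) := by
  have h2 : (2 : ℝ) ≤ Real.exp 1 := by linarith [Real.exp_one_gt_d9]
  calc ((2 : ℝ) ^ m) ^ k ≤ (Real.exp 1 ^ m) ^ k := by gcongr
    _ = Real.exp (m * k) := by rw [← pow_mul, ← Real.exp_nat_mul]; push_cast; ring_nf
    _ ≤ _ := Real.exp_le_exp.mpr (by gcongr)

lemma measure_abs_powSum_increment_ge_le {p q : ℝ} (hp : 1 ≤ p) (hq2 : 2 ≤ q)
    (hq : 2 * p - 2 ≤ q) {B V : ℝ} (hV0 : 0 < V) (hV : p ^ 2 * (n + B) ≤ V)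
    {x y : Fin k → ℝ} (hx : ∑ j, x j ^ 2 = 1) (hy : ∑ j, y j ^ 2 = 1) {d : ℝ}
    (hxy : ∑ j, (x j - y j) ^ 2 ≤ d ^ 2) {t : ℝ} (ht : 0 < t) :
    gaussMatrix n k (sphereBound n k q B ∩
      {g | t ≤ |powSum p (mulVec g y) - powSum p (mulVec g x)|}) ≤
      ENNReal.ofReal (2 * Real.exp (-t ^ 2 / (5 * d ^ 2 * V))) := by
  have h1 := measure_powSum_increment_le (n := n) hp hq2 hq hV0 hV hx hy hxy ht
  have h2 := measure_powSum_increment_le (n := n) hp hq2 hq hV0 hV hy hx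
    ((Finset.sum_congr rfl fun j _ => by ring).trans_le hxy) ht
  refine (measure_mono ?_).trans ((measure_union_le _ _).trans ((add_le_add h1 h2).trans_eq ?_))
  · rintro g ⟨hg, hgt⟩
    rcases le_abs.mp (show t ≤ |_| from hgt) with h | h
    · exact Or.inl ⟨hg, h⟩
    · exact Or.inr ⟨hg, show t ≤ _ by linarith⟩
  · rw [← ENNReal.ofReal_add (by positivity) (by positivity), two_mul]

lemma measure_sphereBound_inter_deviation_le {p q : ℝ} (hp : 1 ≤ p) (hq2 : 2 ≤ q)
    (hq : 2 * p - 2 ≤ q) {B V : ℝ} (hV0 : 0 < V) (hV : p ^ 2 * (n + B) ≤ V)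
    {e : Fin k → ℝ} (he : ∑ j, e j ^ 2 = 1) {D τ : ℝ} (hk : (k : ℝ) ≤ D) (hD : 1 ≤ D)
    (hτ : 0 < τ) (hτV : 225 * D * V ≤ τ ^ 2) :
    gaussMatrix n k (sphereBound n k q B ∩ {g | ∃ x : Fin k → ℝ, ∑ j, x j ^ 2 = 1 ∧
      4 * τ < |powSum p (mulVec g x) - powSum p (mulVec g e)|}) ≤
      ENNReal.ofReal (4 * Real.exp (-(2 * D))) := by
  classical
  obtain ⟨N, hN0, hN1, hN2, hN3⟩ := exists_sphere_nets he
  let t : ℕ → ℝ := fun s => τ * ((s + 1) * (1 / 2) ^ s)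
  let Q : ℕ → Finset ((Fin k → ℝ) × (Fin k → ℝ)) := fun s =>
    (N s ×ˢ N (s + 1)).filter fun y => ∑ j, (y.1 j - y.2 j) ^ 2 ≤ (3 * (1 / 2) ^ s) ^ 2
  let E : (Fin k → ℝ) × (Fin k → ℝ) → ℕ → Set (Fin n → Fin k → ℝ) := fun y s =>
    sphereBound n k q B ∩ {g | t s ≤ |powSum p (mulVec g y.2) - powSum p (mulVec g y.1)|}
  have hsub : sphereBound n k q B ∩ {g | ∃ x : Fin k → ℝ, ∑ j, x j ^ 2 = 1 ∧
      4 * τ < |powSum p (mulVec g x) - powSum p (mulVec g e)|} ⊆ ⋃ s, ⋃ y ∈ Q s, E y s := by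
    rintro g ⟨hg, x, hx, hgx⟩
    by_contra hcon
    simp only [Set.mem_iUnion, not_exists] at hcon
    refine hgx.not_ge (abs_sub_le_of_nets (f := fun x => powSum p (mulVec g x)) hN0 hN2
      ((continuous_powSum (by linarith)).comp
        (continuous_mulVec.comp (Continuous.prodMk_right g))) hτ.le (fun s y hy z hz hyz => ?_) hx)
    by_contra hlt
    exact hcon s (y, z) (Finset.mem_filter.mpr ⟨Finset.mem_product.mpr ⟨hy, hz⟩, hyz⟩)
      ⟨hg, (lt_of_not_ge hlt).le⟩
  have hE : ∀ s, ∀ y ∈ Q s, gaussMatrix n k (E y s) ≤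
      ENNReal.ofReal (2 * Real.exp (-(5 * (s + 1) * D))) := by
    intro s y hy
    obtain ⟨hy1, hy2⟩ := Finset.mem_filter.mp hy
    obtain ⟨hy3, hy4⟩ := Finset.mem_product.mp hy1
    refine (measure_abs_powSum_increment_ge_le hp hq2 hq hV0 hV (hN1 _ _ hy3) (hN1 _ _ hy4) hy2
      (by positivity)).trans (ENNReal.ofReal_le_ofReal ?_)
    gcongr
    have h1 : (t s) ^ 2 / (5 * (3 * (1 / 2) ^ s) ^ 2 * V) = (s + 1) ^ 2 * (τ ^ 2 / (45 * V)) := by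
      simp only [t]; field_simp; norm_num
    have h2 : 5 * D ≤ τ ^ 2 / (45 * V) := by
      rw [le_div_iff₀ (by positivity)]; linarith
    have hs : (0 : ℝ) ≤ s := Nat.cast_nonneg s
    have h3 : ((s : ℝ) + 1) * (5 * D) ≤ (s + 1) ^ 2 * (τ ^ 2 / (45 * V)) := by
      calc ((s : ℝ) + 1) * (5 * D) ≤ (s + 1) ^ 2 * (5 * D) := by gcongr; nlinarith
        _ ≤ _ := by gcongr
    rw [neg_div, h1]
    linarith
  have hQ : ∀ s, ((Q s).card : ℝ) ≤ Real.exp (3 * (s + 1) * D) := by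
    intro s
    have h1 : ((Q s).card : ℝ) ≤ (N s).card * (N (s + 1)).card := by
      exact_mod_cast (Finset.card_filter_le _ _).trans_eq (Finset.card_product _ _)
    have hs : (0 : ℝ) ≤ s := Nat.cast_nonneg s
    calc ((Q s).card : ℝ) ≤ (2 ^ (s + 1)) ^ k * (2 ^ (s + 1 + 1)) ^ k :=
          h1.trans (by gcongr <;> exact hN3 _)
      _ ≤ Real.exp ((s + 1 : ℕ) * D) * Real.exp ((s + 1 + 1 : ℕ) * D) := by
          gcongr <;> exact two_pow_le_exp hk
      _ ≤ _ := by
          rw [← Real.exp_add]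
          refine Real.exp_le_exp.mpr ?_
          push_cast
          nlinarith
  have hsum : ∀ s : ℕ, gaussMatrix n k (⋃ y ∈ Q s, E y s) ≤
      ENNReal.ofReal (2 * Real.exp (-(2 * D)) * (1 / 2) ^ s) := by
    intro s
    refine (measure_biUnion_finset_le _ _).trans ((Finset.sum_le_sum (hE s)).trans ?_)
    rw [Finset.sum_const, nsmul_eq_mul, ← ENNReal.ofReal_natCast,
      ← ENNReal.ofReal_mul (by positivity)]
    refine ENNReal.ofReal_le_ofReal ?_
    have hhalf : Real.exp (-(2 * D)) ≤ 1 / 2 := by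
      have h2 : (2 : ℝ) ≤ Real.exp (2 * D) := by linarith [Real.add_one_le_exp (2 * D)]
      rw [Real.exp_neg, one_div]
      gcongr
    calc _ ≤ Real.exp (3 * (s + 1) * D) * (2 * Real.exp (-(5 * (s + 1) * D))) := by
          gcongr; exact hQ s
      _ = 2 * Real.exp (-(2 * D)) * Real.exp (-(2 * D)) ^ s := by
          rw [← Real.exp_nat_mul, mul_left_comm, mul_assoc 2, ← Real.exp_add, ← Real.exp_add]
          congr 2
          ring
      _ ≤ _ := by gcongr
  refine (measure_mono hsub).trans ((measure_iUnion_le _).trans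
    ((ENNReal.tsum_le_tsum hsum).trans ?_))
  rw [← ENNReal.ofReal_tsum_of_nonneg (fun _ => by positivity)
    (summable_geometric_two.mul_left _), tsum_mul_left, tsum_geometric_two]
  exact ENNReal.ofReal_le_ofReal (by linarith)

end Chaining

section Median

variable {n k : ℕ}

lemma IsMedian.nonneg_of_pNorm {p M : ℝ} (hM : IsMedian (_root_.stdGaussian n) (pNorm p) M) :
    0 ≤ M := by
  by_contra! h
  have h2 := hM.2
  have : {u : Fin n → ℝ | pNorm p u ≤ M} = ∅ :=
    Set.eq_empty_of_forall_notMem fun u (hu : pNorm p u ≤ M) =>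
      absurd (Real.rpow_nonneg (powSum_nonneg p u) (1 / p)) (hu.trans_lt h).not_ge
  rw [this, measure_empty] at h2
  simp at h2

lemma IsMedian.powSum_of_pNorm {p M : ℝ} (hp : 0 < p)
    (hM : IsMedian (_root_.stdGaussian n) (pNorm p) M) :
    IsMedian (_root_.stdGaussian n) (powSum p) (M ^ p) := by
  have hM0 := hM.nonneg_of_pNorm
  have h1 : ∀ u : Fin n → ℝ, M ^ p ≤ powSum p u ↔ M ≤ pNorm p u := fun u => by
    rw [pNorm_eq_powSum_rpow, one_div, Real.le_rpow_inv_iff_of_pos hM0 (powSum_nonneg _ _) hp]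
  have h2 : ∀ u : Fin n → ℝ, powSum p u ≤ M ^ p ↔ pNorm p u ≤ M := fun u => by
    rw [pNorm_eq_powSum_rpow, one_div, Real.rpow_inv_le_iff_of_pos (powSum_nonneg _ _) hM0 hp]
  simp_rw [IsMedian, h1, h2]
  exact hM

lemma exp_neg_le_measureReal_gaussian {p : ℝ} (hp : 1 ≤ p) :
    Real.exp (-(3 * p)) ≤ (gaussianReal 0 1).real {z | Real.sqrt p ≤ |z|} := by
  have hs : 1 ≤ Real.sqrt p := Real.one_le_sqrt.mpr hp
  have hsp : Real.sqrt p ^ 2 = p := Real.sq_sqrt (by linarith)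
  have h2 : Real.sqrt (2 * Real.pi) ≤ Real.exp 1 := by
    refine Real.sqrt_le_iff.mpr ⟨(Real.exp_pos _).le, ?_⟩
    nlinarith [Real.exp_one_gt_d9, Real.pi_lt_d2]
  have hpdf : ∀ z ∈ Set.Icc (Real.sqrt p) (Real.sqrt p + 1),
      Real.exp (-(3 * p)) ≤ gaussianPDFReal 0 1 z := by
    intro z hz
    have hz2 : z ^ 2 ≤ 4 * p := by nlinarith [hz.1, hz.2]
    rw [gaussianPDFReal_def]
    simp only [NNReal.coe_one, mul_one, sub_zero]
    calc Real.exp (-(3 * p)) ≤ Real.exp (-1) * Real.exp (-z ^ 2 / 2) := by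
          rw [← Real.exp_add]; exact Real.exp_le_exp.mpr (by linarith)
      _ ≤ _ := by
          rw [Real.exp_neg]; gcongr
  rw [measureReal_def, ← ENNReal.ofReal_le_iff_le_toReal (measure_ne_top _ _)]
  calc ENNReal.ofReal (Real.exp (-(3 * p)))
      = ∫⁻ _ in Set.Icc (Real.sqrt p) (Real.sqrt p + 1), ENNReal.ofReal (Real.exp (-(3 * p))) := by
        simp
    _ ≤ ∫⁻ z in Set.Icc (Real.sqrt p) (Real.sqrt p + 1), gaussianPDF 0 1 z :=
        setLIntegral_mono' measurableSet_Icc fun z hz => ENNReal.ofReal_le_ofReal (hpdf z hz)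
    _ = gaussianReal 0 1 (Set.Icc (Real.sqrt p) (Real.sqrt p + 1)) :=
        (gaussianReal_apply _ one_ne_zero _).symm
    _ ≤ _ := measure_mono fun z hz => hz.1.trans (le_abs_self z)

lemma integral_exp_neg_abs_rpow_le {p : ℝ} (hp : 1 ≤ p) :
    ∫ z, Real.exp (-(p ^ (p / 2))⁻¹ * |z| ^ p) ∂(gaussianReal 0 1) ≤
      Real.exp (-(Real.exp (-(3 * p)) / 2)) := by
  set A : Set ℝ := {z | Real.sqrt p ≤ |z|}
  have hA : MeasurableSet A := measurableSet_le measurable_const measurable_norm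
  have hp0 : 0 < p := by linarith
  have hL : 0 < p ^ (p / 2) := by positivity
  have hle : ∀ z : ℝ, Real.exp (-(p ^ (p / 2))⁻¹ * |z| ^ p) ≤ 1 - A.indicator (fun _ => 1 / 2) z := by
    intro z
    by_cases hz : z ∈ A
    · have h1 : p ^ (p / 2) ≤ |z| ^ p := by
        have := Real.rpow_le_rpow (Real.sqrt_nonneg p) hz hp0.le
        rwa [Real.sqrt_eq_rpow, ← Real.rpow_mul hp0.le, one_div_mul_eq_div] at this
      have h2 : 1 ≤ (p ^ (p / 2))⁻¹ * |z| ^ p := by rwa [le_inv_mul_iff₀ hL, mul_one]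
      have h3 : Real.exp (-1) ≤ 1 / 2 := by
        rw [Real.exp_neg, one_div]
        gcongr
        linarith [Real.exp_one_gt_d9]
      rw [Set.indicator_of_mem hz]
      have := Real.exp_le_exp.mpr (show -(p ^ (p / 2))⁻¹ * |z| ^ p ≤ -1 by linarith)
      linarith
    · rw [Set.indicator_of_notMem hz, sub_zero, Real.exp_le_one_iff, neg_mul, neg_nonpos]
      positivity
  have hint : Integrable (A.indicator fun _ => (1 / 2 : ℝ)) (gaussianReal 0 1) :=
    (integrable_const _).indicator hA
  calc _ ≤ ∫ z, (1 - A.indicator (fun _ => (1 / 2 : ℝ)) z) ∂(gaussianReal 0 1) :=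
        integral_mono_of_nonneg (.of_forall fun _ => (Real.exp_pos _).le)
          ((integrable_const _).sub hint) (.of_forall hle)
    _ = 1 - (gaussianReal 0 1).real A / 2 := by
        rw [integral_sub (integrable_const _) hint, integral_indicator_const _ hA]
        simp [div_eq_mul_inv]
    _ ≤ 1 - Real.exp (-(3 * p)) / 2 := by linarith [exp_neg_le_measureReal_gaussian hp]
    _ ≤ _ := Real.one_sub_le_exp_neg _

/-- Any median of `powSum p` is at least of the order of `n p ^ (p / 2)` up to `exp (O (p))`. -/
lemma IsMedian.powSum_lower_bound {p : ℝ} (hp : 1 ≤ p) (hn : 4 ≤ n * Real.exp (-(3 * p))) {m : ℝ}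
    (hm : IsMedian (_root_.stdGaussian n) (powSum p) m) :
    n * p ^ (p / 2) * Real.exp (-(5 * p)) ≤ m := by
  have hp0 : 0 < p := by linarith
  set L := p ^ (p / 2)
  have hL : 0 < L := by positivity
  set π := Real.exp (-(3 * p)) with hπ
  have hcont : Continuous fun u : Fin n → ℝ => Real.exp (-L⁻¹ * powSum p u) :=
    Real.continuous_exp.comp (continuous_const.mul (continuous_powSum hp0.le))
  have hint : Integrable (fun u : Fin n → ℝ => Real.exp (-L⁻¹ * powSum p u))
      (_root_.stdGaussian n) := by
    refine Integrable.of_bound hcont.aestronglyMeasurable 1 (.of_forall fun u => ?_)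
    have := powSum_nonneg p u
    rw [Real.norm_eq_abs, Real.abs_exp, Real.exp_le_one_iff, neg_mul, neg_nonpos]
    positivity
  have hmgf : mgf (powSum p) (_root_.stdGaussian n) (-L⁻¹) ≤ Real.exp (-(π / 2)) ^ n := by
    calc mgf (powSum p) (_root_.stdGaussian n) (-L⁻¹)
        = ∫ u : Fin n → ℝ, ∏ i, Real.exp (-L⁻¹ * |u i| ^ p) ∂(_root_.stdGaussian n) := by
          simp_rw [mgf, powSum, Finset.mul_sum, Real.exp_sum]
      _ = (∫ z, Real.exp (-L⁻¹ * |z| ^ p) ∂(gaussianReal 0 1)) ^ n := by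
          have := integral_fintype_prod_eq_pow (ι := Fin n) (μ := gaussianReal 0 1)
            (fun z : ℝ => Real.exp (-L⁻¹ * |z| ^ p))
          rwa [Fintype.card_fin] at this
      _ ≤ _ := by
          gcongr
          exact integral_exp_neg_abs_rpow_le hp
  have hch := measure_le_le_exp_mul_mgf (μ := _root_.stdGaussian n) (X := powSum p)
    (L * (n * π / 4)) (neg_nonpos.mpr (inv_nonneg.mpr hL.le)) hint
  have hsmall : (_root_.stdGaussian n).real {u | powSum p u ≤ L * (n * π / 4)} < 1 / 2 := by
    calc _ ≤ Real.exp (- -L⁻¹ * (L * (n * π / 4))) * Real.exp (-(π / 2)) ^ n :=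
          hch.trans (by gcongr)
      _ = Real.exp (-(n * π / 4)) := by
          rw [← Real.exp_nat_mul, ← Real.exp_add]
          congr 1
          field_simp
          ring
      _ ≤ Real.exp (-1) := Real.exp_le_exp.mpr (by linarith)
      _ < 1 / 2 := by
          rw [Real.exp_neg, one_div]
          gcongr
          linarith [Real.exp_one_gt_d9]
  have hm2 : L * (n * π / 4) < m := by
    by_contra! hcon
    have h1 : (1 : ENNReal) / 2 ≤ _root_.stdGaussian n {u | powSum p u ≤ L * (n * π / 4)} :=
      hm.2.trans (measure_mono fun u (hu : _ ≤ m) => hu.trans hcon)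
    have h2 := ENNReal.toReal_mono (measure_ne_top _ _) h1
    rw [← measureReal_def] at h2
    norm_num at h2 hsmall
    linarith
  have h4 : Real.exp (-(5 * p)) ≤ π / 4 := by
    have h1 : (4 : ℝ) ≤ Real.exp (2 * p) := by
      calc (4 : ℝ) ≤ Real.exp 1 ^ 2 := by nlinarith [Real.exp_one_gt_d9]
        _ = Real.exp (2 * 1) := by rw [← Real.exp_nat_mul]; norm_num
        _ ≤ _ := by gcongr
    have h2 : Real.exp (-(5 * p)) * Real.exp (2 * p) = π := by
      rw [hπ, ← Real.exp_add]; congr 1; ring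
    nlinarith [Real.exp_pos (-(5 * p))]
  calc (n : ℝ) * L * Real.exp (-(5 * p)) ≤ n * L * (π / 4) := by gcongr
    _ = L * (n * π / 4) := by ring
    _ ≤ m := hm2.le

lemma measure_exists_deviation_le (hn : 0 < n) {p q D : ℝ} (hp : 1 ≤ p) (hq2 : 2 ≤ q)
    (hq : 2 * p - 2 ≤ q) (hk : (k : ℝ) ≤ D) (hD : 2 ≤ D) {V : ℝ} (hV0 : 0 < V)
    (hV : p ^ 2 * (n + 20 ^ q * (n * q ^ (q / 2) + D ^ (q / 2))) ≤ V)
    {τ : ℝ} (hτ : 0 < τ) (hτV : 225 * D * V ≤ τ ^ 2) {m : ℝ}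
    (hm : IsMedian (_root_.stdGaussian n) (powSum p) m) :
    gaussMatrix n k {g | ∃ x : Fin k → ℝ, ∑ j, x j ^ 2 = 1 ∧
      5 * τ < |powSum p (mulVec g x) - m|} ≤ ENNReal.ofReal (18 * Real.exp (-D)) := by
  by_cases hex : ∃ e : Fin k → ℝ, ∑ j, e j ^ 2 = 1
  swap
  · rw [show {g : Fin n → Fin k → ℝ | ∃ x : Fin k → ℝ, ∑ j, x j ^ 2 = 1 ∧
      5 * τ < |powSum p (mulVec g x) - m|} = ∅ from
        Set.eq_empty_of_forall_notMem fun g ⟨x, hx, _⟩ => hex ⟨x, hx⟩]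
    simp
  obtain ⟨e, he⟩ := hex
  set B := 20 ^ q * (n * q ^ (q / 2) + D ^ (q / 2))
  have hbase := measure_powSum_sub_median_ge_le hp hq2 hq hV0 hV hτ hm
  have h1 : gaussMatrix n k {g | τ ≤ |powSum p (mulVec g e) - m|} ≤
      ENNReal.ofReal (12 * Real.exp (-(3 * D))) := by
    have hB : MeasurableSet {u : Fin n → ℝ | τ ≤ |powSum p u - m|} :=
      measurableSet_le measurable_const
        ((continuous_powSum (by linarith)).measurable.sub_const m).abs
    have := (measurePreserving_mulVec (n := n) he).measure_preimage hB.nullMeasurableSet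
    refine this.trans_le (hbase.trans ?_)
    have h2 := measure_compl_sphereBound_le (n := n) (k := 2) hn hq2 (D := D) (by exact_mod_cast hD)
    have h3 : Real.exp (-τ ^ 2 / (10 * V)) ≤ Real.exp (-(3 * D)) := by
      refine Real.exp_le_exp.mpr ?_
      rw [neg_div, neg_le_neg_iff, le_div_iff₀ (by positivity)]
      nlinarith [mul_pos (by linarith : 0 < D) hV0]
    calc _ ≤ 4 * (ENNReal.ofReal (2 * Real.exp (-(3 * D))) +
          ENNReal.ofReal (Real.exp (-(3 * D)))) := by gcongr
      _ = ENNReal.ofReal 4 * (ENNReal.ofReal (2 * Real.exp (-(3 * D))) +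
          ENNReal.ofReal (Real.exp (-(3 * D)))) := by norm_num
      _ = _ := by
        rw [← ENNReal.ofReal_add (by positivity) (by positivity),
          ← ENNReal.ofReal_mul (by norm_num)]
        congr 1
        ring
  have h2 := measure_sphereBound_inter_deviation_le (n := n) hp hq2 hq hV0 hV he hk
    (by linarith) hτ hτV
  have h3 := measure_compl_sphereBound_le (n := n) (k := k) hn hq2 hk
  refine (measure_mono (fun g hg => ?_)).trans ((measure_union_le _ _).trans
    ((add_le_add h3 ((measure_union_le _ _).trans (add_le_add h2 h1))).trans ?_))
  · obtain ⟨x, hx, hgx⟩ := hg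
    by_cases hgS : g ∈ sphereBound n k q B
    · refine Or.inr ?_
      by_cases hge : τ ≤ |powSum p (mulVec g e) - m|
      · exact Or.inr hge
      · refine Or.inl ⟨hgS, x, hx, ?_⟩
        have := abs_sub_le (powSum p (mulVec g x)) (powSum p (mulVec g e)) m
        push Not at hge
        linarith
    · exact Or.inl hgS
  · rw [← ENNReal.ofReal_add (by positivity) (by positivity),
      ← ENNReal.ofReal_add (by positivity) (by positivity)]
    refine ENNReal.ofReal_le_ofReal ?_
    have h5 : Real.exp (-(3 * D)) ≤ Real.exp (-D) := Real.exp_le_exp.mpr (by linarith)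
    have h6 : Real.exp (-(2 * D)) ≤ Real.exp (-D) := Real.exp_le_exp.mpr (by linarith)
    linarith

lemma pNorm_bounds_of_abs_powSum_sub_le {p M ε : ℝ} (hp : 1 ≤ p) (hM : 0 ≤ M) (hε : 0 < ε)
    (hε1 : ε < 1) {u : Fin n → ℝ} (h : |powSum p u - M ^ p| ≤ ε * M ^ p) :
    (1 - ε) * M ≤ pNorm p u ∧ pNorm p u ≤ (1 + ε) * M := by
  have hp0 : 0 < p := by linarith
  have hMp : 0 ≤ M ^ p := by positivity
  obtain ⟨h1, h2⟩ := abs_le.mp h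
  have h3 : (1 - ε) ^ p ≤ 1 - ε :=
    Real.rpow_le_self_of_le_one (by linarith) (by linarith) hp
  have h4 : 1 + ε ≤ (1 + ε) ^ p := Real.self_le_rpow_of_one_le (by linarith) hp
  rw [pNorm_eq_powSum_rpow, one_div]
  constructor
  · rw [Real.le_rpow_inv_iff_of_pos (mul_nonneg (by linarith) hM) (powSum_nonneg _ _) hp0,
      Real.mul_rpow (by linarith) hM]
    nlinarith
  · rw [Real.rpow_inv_le_iff_of_pos (powSum_nonneg _ _) (by positivity) hp0,
      Real.mul_rpow (by linarith) hM]
    nlinarith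

/-- Almost isometry of a Gaussian matrix with the failure probability in terms of `D ≥ k`,
provided that `D` is small enough with respect to the variance proxy. -/
lemma le_measure_almost_isometry {p q D ε : ℝ} (hp : 1 ≤ p) (hq2 : 2 ≤ q)
    (hq : 2 * p - 2 ≤ q) (hk : (k : ℝ) ≤ D) (hD : 2 ≤ D) (hε : 0 < ε) (hε1 : ε < 1)
    (hn : 4 ≤ n * Real.exp (-(3 * p)))
    (hDV : 5625 * D * (p ^ 2 * (n + 20 ^ q * (n * q ^ (q / 2) + D ^ (q / 2)))) ≤
      (ε * (n * p ^ (p / 2) * Real.exp (-(5 * p)))) ^ 2)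
    {M : ℝ} (hM : IsMedian (_root_.stdGaussian n) (pNorm p) M) :
    1 - 18 * Real.exp (-D) ≤ ((gaussMatrix n k) {g | ∀ x : Fin k → ℝ,
      (1 - ε) * M * eucNorm x ≤ pNorm p (mulVec g x) ∧
      pNorm p (mulVec g x) ≤ (1 + ε) * M * eucNorm x}).toReal := by
  have hn0 : 0 < n := Nat.pos_of_ne_zero fun h => by rw [h] at hn; norm_num at hn
  have hM0 := hM.nonneg_of_pNorm
  have hm := hM.powSum_of_pNorm (by linarith)
  have hlow := hm.powSum_lower_bound hp hn
  have hv : 0 < n * p ^ (p / 2) * Real.exp (-(5 * p)) := by positivity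
  set T := {g : Fin n → Fin k → ℝ | ∀ x : Fin k → ℝ,
      (1 - ε) * M * eucNorm x ≤ pNorm p (mulVec g x) ∧
      pNorm p (mulVec g x) ≤ (1 + ε) * M * eucNorm x}
  have hdev := measure_exists_deviation_le (k := k) hn0 hp hq2 hq hk hD (by positivity) le_rfl
    (τ := ε * M ^ p / 5) (by have := hv.trans_le hlow; positivity) (by
      have : (ε * (n * p ^ (p / 2) * Real.exp (-(5 * p)))) ^ 2 ≤ (ε * M ^ p) ^ 2 := by gcongr
      rw [div_pow]
      linarith) hm
  have hT : Tᶜ ⊆ {g | ∃ x : Fin k → ℝ, ∑ j, x j ^ 2 = 1 ∧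
      5 * (ε * M ^ p / 5) < |powSum p (mulVec g x) - M ^ p|} := by
    intro g hg
    by_contra hcon
    refine hg (pNorm_mulVec_bounds_of_sphere hp fun x hx =>
      pNorm_bounds_of_abs_powSum_sub_le hp hM0 hε hε1 ?_)
    by_contra hlt
    exact hcon ⟨x, hx, by linarith⟩
  have h1 : (1 : ENNReal) ≤ gaussMatrix n k T + ENNReal.ofReal (18 * Real.exp (-D)) := by
    calc (1 : ENNReal) = gaussMatrix n k (T ∪ Tᶜ) := by simp
      _ ≤ _ := (measure_union_le _ _).trans (add_le_add_right ((measure_mono hT).trans hdev) _)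
  have h2 := ENNReal.toReal_mono (by finiteness) h1
  rw [ENNReal.toReal_add (by finiteness) (by finiteness), ENNReal.toReal_one,
    ENNReal.toReal_ofReal (by positivity)] at h2
  linarith

end Median

section Variance

lemma two_pow_le_exp_natCast (m : ℕ) : (2 : ℝ) ^ m ≤ Real.exp m := by
  have h2 : (2 : ℝ) ≤ Real.exp 1 := by linarith [Real.exp_one_gt_d9]
  calc (2 : ℝ) ^ m ≤ Real.exp 1 ^ m := by gcongr
    _ = Real.exp m := by rw [← Real.exp_nat_mul, mul_one]

lemma variance_bound_of_le_two {N p D ε : ℝ} (hN : 0 ≤ N) (hp : 1 ≤ p) (hp2 : p ≤ 2)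
    (hε : 0 < ε) (hε1 : ε < 1) (hD : D = Real.exp (-100) * N * ε ^ 2) :
    5625 * D * (p ^ 2 * (N + 20 ^ (2 : ℝ) * (N * 2 ^ ((2 : ℝ) / 2) + D ^ ((2 : ℝ) / 2)))) ≤
      (ε * (N * p ^ (p / 2) * Real.exp (-(5 * p)))) ^ 2 := by
  have hD0 : 0 ≤ D := by rw [hD]; positivity
  have hc : Real.exp (-100) ≤ 1 := Real.exp_le_one_iff.mpr (by norm_num)
  have hDN : D ≤ N := by
    have hε2 : ε ^ 2 ≤ 1 := pow_le_one₀ hε.le hε1.le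
    calc D = Real.exp (-100) * N * ε ^ 2 := hD
      _ ≤ 1 * N * 1 := by gcongr
      _ = N := by ring
  have hpp : 1 ≤ p ^ (p / 2) := Real.one_le_rpow hp (by linarith)
  have hexp : Real.exp (-10) ≤ Real.exp (-(5 * p)) := Real.exp_le_exp.mpr (by linarith)
  have hconst : 27022500 * Real.exp (-100) ≤ Real.exp (-10) ^ 2 := by
    have h1 : (27022500 : ℝ) ≤ Real.exp 80 := by
      have := two_pow_le_exp_natCast 80
      norm_num at this ⊢
      linarith
    calc 27022500 * Real.exp (-100) ≤ Real.exp 80 * Real.exp (-100) := by gcongr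
      _ = Real.exp (-10) ^ 2 := by rw [← Real.exp_add, ← Real.exp_nat_mul]; norm_num
  norm_num
  calc 5625 * D * (p ^ 2 * (N + 400 * (N * 2 + D)))
      ≤ 5625 * D * (2 ^ 2 * (N + 400 * (N * 2 + N))) := by gcongr
    _ = 27022500 * Real.exp (-100) * (ε * N) ^ 2 := by rw [hD]; ring
    _ ≤ Real.exp (-10) ^ 2 * (ε * N) ^ 2 := by gcongr
    _ = (ε * (N * 1 * Real.exp (-10))) ^ 2 := by ring
    _ ≤ _ := by gcongr

lemma variance_bound_of_two_lt {N p D ε : ℝ} (hN : 0 ≤ N) (hp : 2 < p) (hε : 0 < ε)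
    (hD0 : 0 < D) (hD1 : D ≤ Real.exp (-100) * (Real.exp (-100) ^ p * N * ε ^ 2))
    (hD2 : D ≤ Real.exp (-100) * (p * N ^ (2 / p) * ε ^ (2 / p))) :
    5625 * D * (p ^ 2 * (N + 20 ^ (2 * p - 2) *
      (N * (2 * p - 2) ^ ((2 * p - 2) / 2) + D ^ ((2 * p - 2) / 2)))) ≤
      (ε * (N * p ^ (p / 2) * Real.exp (-(5 * p)))) ^ 2 := by
  have hp0 : 0 < p := by linarith
  have hc : Real.exp (-100) ≤ 1 := Real.exp_le_one_iff.mpr (by norm_num)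
  have hcp : Real.exp (-100) ^ p = Real.exp (-(100 * p)) := by rw [← Real.exp_mul]; congr 1; ring
  set X := N ^ 2 * ε ^ 2 * p ^ p with hX
  have hX0 : 0 ≤ X := by positivity
  have hDp : D ^ p ≤ Real.exp (-(100 * p)) * X := by
    calc D ^ p ≤ (Real.exp (-100) * (p * N ^ (2 / p) * ε ^ (2 / p))) ^ p := by gcongr
      _ = Real.exp (-(100 * p)) * (p ^ p * (N ^ (2 / p)) ^ p * (ε ^ (2 / p)) ^ p) := by
          rw [Real.mul_rpow (by positivity) (by positivity),
            Real.mul_rpow (by positivity) (by positivity),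
            Real.mul_rpow (by positivity) (by positivity), hcp]
      _ = _ := by
          rw [← Real.rpow_mul hN, ← Real.rpow_mul hε.le, div_mul_cancel₀ _ hp0.ne',
            Real.rpow_two, Real.rpow_two, hX]
          ring
  have h2p : (1 : ℝ) ≤ 2 * p := by linarith
  have hDN : D * N * (2 * p) ^ p ≤ Real.exp p * Real.exp (-(100 * p)) * X := by
    have h2e : (2 : ℝ) ^ p ≤ Real.exp p := by
      rw [← Real.exp_one_rpow]
      gcongr
      linarith [Real.exp_one_gt_d9]
    calc D * N * (2 * p) ^ p
        ≤ 1 * (Real.exp (-100) ^ p * N * ε ^ 2) * N * (2 * p) ^ p := by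
          have : D ≤ 1 * (Real.exp (-100) ^ p * N * ε ^ 2) := hD1.trans (by gcongr)
          gcongr
      _ = 2 ^ p * Real.exp (-(100 * p)) * X := by
          rw [hcp, Real.mul_rpow (by norm_num) hp0.le, hX]; ring
      _ ≤ _ := by gcongr
  have h20 : (20 : ℝ) ^ (2 * p - 2) ≤ Real.exp (6 * p) := by
    have he : (20 : ℝ) ≤ Real.exp 3 := by
      have h1 := Real.exp_one_gt_d9
      have h3 : Real.exp 3 = Real.exp 1 ^ 3 := by rw [← Real.exp_nat_mul]; norm_num
      rw [h3]
      calc (20 : ℝ) ≤ 2.718 ^ 3 := by norm_num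
        _ ≤ _ := by gcongr; linarith
    calc (20 : ℝ) ^ (2 * p - 2) ≤ 20 ^ (2 * p) :=
          Real.rpow_le_rpow_of_exponent_le (by norm_num) (by linarith)
      _ ≤ Real.exp 3 ^ (2 * p) := by gcongr
      _ = Real.exp (6 * p) := by rw [← Real.exp_mul]; congr 1; ring
  have hp2 : p ^ 2 ≤ Real.exp (2 * p) := by
    have : p ≤ Real.exp p := by linarith [Real.add_one_le_exp p]
    calc p ^ 2 ≤ Real.exp p ^ 2 := by gcongr
      _ = _ := by rw [← Real.exp_nat_mul]; norm_num
  have hq1 : (2 * p - 2) ^ (p - 1) ≤ (2 * p) ^ p := by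
    calc (2 * p - 2) ^ (p - 1) ≤ (2 * p) ^ (p - 1) :=
          Real.rpow_le_rpow (by linarith) (by linarith) (by linarith)
      _ ≤ _ := Real.rpow_le_rpow_of_exponent_le h2p (by linarith)
  have h1q : 1 ≤ (2 * p) ^ p := Real.one_le_rpow h2p hp0.le
  have h1e : 1 ≤ Real.exp (6 * p) := Real.one_le_exp (by positivity)
  have h1p : 1 ≤ Real.exp p := Real.one_le_exp hp0.le
  have hconst : (16875 : ℝ) ≤ Real.exp (10 * p) := by
    calc (16875 : ℝ) ≤ 2 ^ 20 := by norm_num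
      _ ≤ Real.exp ((20 : ℕ) : ℝ) := two_pow_le_exp_natCast 20
      _ ≤ _ := Real.exp_le_exp.mpr (by push_cast; linarith)
  have hDD : D * D ^ (p - 1) = D ^ p := by
    rw [← Real.rpow_one_add' hD0.le (by linarith)]; congr 1; ring
  have hhalf : (2 * p - 2) / 2 = p - 1 := by ring
  rw [hhalf]
  have hq0 : 0 ≤ (2 * p - 2) ^ (p - 1) := Real.rpow_nonneg (by linarith) _
  calc 5625 * D * (p ^ 2 * (N + 20 ^ (2 * p - 2) * (N * (2 * p - 2) ^ (p - 1) + D ^ (p - 1))))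
      ≤ 5625 * D * (Real.exp (2 * p) * (N * (2 * p) ^ p * Real.exp (6 * p) +
          Real.exp (6 * p) * (N * (2 * p) ^ p + D ^ (p - 1)))) := by
        gcongr
        calc N = N * 1 * 1 := by ring
          _ ≤ _ := by gcongr
    _ = 5625 * Real.exp (2 * p) * Real.exp (6 * p) *
          (2 * (D * N * (2 * p) ^ p) + D * D ^ (p - 1)) := by ring
    _ ≤ 5625 * Real.exp (2 * p) * Real.exp (6 * p) *
          (2 * (Real.exp p * Real.exp (-(100 * p)) * X) +
            Real.exp p * (Real.exp (-(100 * p)) * X)) := by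
        rw [hDD]
        gcongr
        exact hDp.trans (le_mul_of_one_le_left (by positivity) h1p)
    _ = 16875 * (Real.exp (2 * p) * Real.exp (6 * p) * Real.exp p * Real.exp (-(100 * p))) * X := by
        ring
    _ ≤ Real.exp (10 * p) *
          (Real.exp (2 * p) * Real.exp (6 * p) * Real.exp p * Real.exp (-(100 * p))) * X := by
        gcongr
    _ = Real.exp (-(81 * p)) * X := by
        rw [← Real.exp_add, ← Real.exp_add, ← Real.exp_add, ← Real.exp_add]; ring_nf
    _ ≤ Real.exp (-(10 * p)) * X := by
        gcongr; linarith
    _ = _ := by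
        have h1 : p ^ p = (p ^ (p / 2)) ^ 2 := by
          rw [← Real.rpow_natCast, ← Real.rpow_mul hp0.le]; norm_num
        have h2 : Real.exp (-(10 * p)) = Real.exp (-(5 * p)) ^ 2 := by
          rw [← Real.exp_nat_mul]; congr 1; push_cast; ring
        rw [hX, h1, h2]
        ring

end Variance

/-- Randomized Dvoretzky for `ℓ_p^n` with improved dependence on `ε` and `p`: for all
`C₁ > 0` there exist `c₂ > 0` and universal constants `C, c > 0` such that for `n ≥ 2`,
`1 ≤ p < C₁ ln n`, `ε ∈ (0,1)`, with
`d' = c n ε²` if `p ≤ 2` and `d' = c₂ min{c^p n ε², p n^{2/p} ε^{2/p}}` if `p > 2`,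
and `k ≤ d'`: with probability at least `1 - C exp(-c d')`, for all `x ∈ ℝ^k`,
`(1-ε) M_p |x| ≤ ‖Gx‖_p ≤ (1+ε) M_p |x|`, where `M_p` is a median of `‖·‖_p` under the
standard Gaussian on `ℝ^n` (the law of `Ge₁`). -/
theorem dvoretzky_ell_p :
    ∃ C c : ℝ, 0 < C ∧ 0 < c ∧
      ∀ C₁ : ℝ, 0 < C₁ →
        ∃ c₂ : ℝ, 0 < c₂ ∧
          ∀ (n k : ℕ) (p ε : ℝ), 2 ≤ n → 1 ≤ p → p < C₁ * Real.log n →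
            0 < ε → ε < 1 →
            (k : ℝ) ≤ (if p ≤ 2 then c * n * ε ^ 2
              else c₂ * min (c ^ p * n * ε ^ 2) (p * (n : ℝ) ^ (2 / p) * ε ^ (2 / p))) →
            ∀ M : ℝ, IsMedian (stdGaussian n) (pNorm p) M →
              1 - C * Real.exp (-c *
                  (if p ≤ 2 then c * n * ε ^ 2
                    else c₂ * min (c ^ p * n * ε ^ 2)
                      (p * (n : ℝ) ^ (2 / p) * ε ^ (2 / p)))) ≤
                ((gaussMatrix n k) {g | ∀ x : Fin k → ℝ,
                  (1 - ε) * M * eucNorm x ≤ pNorm p (mulVec g x) ∧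
                  pNorm p (mulVec g x) ≤ (1 + ε) * M * eucNorm x}).toReal := by
  refine ⟨18 * Real.exp 2, Real.exp (-100), by positivity, Real.exp_pos _, fun C₁ _ =>
    ⟨Real.exp (-100), Real.exp_pos _, fun n k p ε _ hp _ hε hε1 hk M hM => ?_⟩⟩
  have hc : Real.exp (-100) ≤ 1 := Real.exp_le_one_iff.mpr (by norm_num)
  have he2 : 1 ≤ Real.exp 2 := Real.one_le_exp (by norm_num)
  have hN : (0 : ℝ) ≤ n := Nat.cast_nonneg n
  have hε2 : ε ^ 2 ≤ 1 := pow_le_one₀ hε.le hε1.le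
  set D := if p ≤ 2 then Real.exp (-100) * n * ε ^ 2
    else Real.exp (-100) * min (Real.exp (-100) ^ p * n * ε ^ 2)
      (p * (n : ℝ) ^ (2 / p) * ε ^ (2 / p)) with hDdef
  have hD0 : 0 ≤ D := (Nat.cast_nonneg k).trans hk
  have hcD : Real.exp (-100) * D ≤ D := mul_le_of_le_one_left hD0 hc
  rcases lt_or_ge D 2 with hD | hD
  · refine le_trans ?_ ENNReal.toReal_nonneg
    have h1 : Real.exp (-2) ≤ Real.exp (-Real.exp (-100) * D) := Real.exp_le_exp.mpr (by linarith)
    have h2 : Real.exp 2 * Real.exp (-2) = 1 := by rw [← Real.exp_add]; norm_num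
    have h3 : Real.exp 2 * Real.exp (-2) ≤ Real.exp 2 * Real.exp (-Real.exp (-100) * D) := by
      gcongr
    linarith
  have hprob : 1 - 18 * Real.exp 2 * Real.exp (-Real.exp (-100) * D) ≤ 1 - 18 * Real.exp (-D) := by
    have h1 : Real.exp (-D) ≤ Real.exp (-Real.exp (-100) * D) := Real.exp_le_exp.mpr (by linarith)
    have h2 := Real.exp_pos (-Real.exp (-100) * D)
    nlinarith
  refine hprob.trans ?_
  rcases le_or_gt p 2 with hp2 | hp2
  · rw [if_pos hp2] at hDdef
    refine le_measure_almost_isometry hp le_rfl (by linarith) hk hD hε hε1 ?_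
      (variance_bound_of_le_two hN hp hp2 hε hε1 hDdef) hM
    have h1 : D ≤ n * Real.exp (-100) := by
      rw [hDdef]
      nlinarith [mul_nonneg (Real.exp_pos (-100)).le hN]
    calc (4 : ℝ) ≤ n * Real.exp (-100) * 2 := by linarith
      _ ≤ n * Real.exp (-100) * Real.exp 94 := by
          gcongr; linarith [Real.add_one_le_exp (94 : ℝ)]
      _ = n * Real.exp (-6) := by rw [mul_assoc, ← Real.exp_add]; norm_num
      _ ≤ _ := by gcongr; linarith
  · rw [if_neg (not_le.mpr hp2)] at hDdef
    have hD1 : D ≤ Real.exp (-100) * (Real.exp (-100) ^ p * n * ε ^ 2) := by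
      rw [hDdef]; gcongr; exact min_le_left _ _
    have hD2 : D ≤ Real.exp (-100) * (p * (n : ℝ) ^ (2 / p) * ε ^ (2 / p)) := by
      rw [hDdef]; gcongr; exact min_le_right _ _
    refine le_measure_almost_isometry hp (by linarith) le_rfl hk hD hε hε1 ?_
      (variance_bound_of_two_lt hN hp2 hε (by linarith) hD1 hD2) hM
    have h1 : D ≤ Real.exp (-1) * (n * Real.exp (-(3 * p))) := by
      calc D ≤ Real.exp (-100) * (Real.exp (-100) ^ p * n * ε ^ 2) := hD1
        _ ≤ Real.exp (-1) * (Real.exp (-(3 * p)) * n * 1) := by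
            rw [← Real.exp_mul]
            gcongr <;> linarith
        _ = _ := by ring
    have h2 : Real.exp (-1) ≤ 1 / 2 := by
      rw [Real.exp_neg, one_div]
      gcongr
      linarith [Real.exp_one_gt_d9]
    have h3 : 0 ≤ n * Real.exp (-(3 * p)) := by positivity
    nlinarith
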